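/- arXiv:1603.05111 — 3 statements merged into one kernel-verified Lean document; each statement's English description precedes it below -/
import Mathlib

section
/- Let n ≥ 5 and let A be a real symmetric n×n matrix such that for every j = 1,…,n there exists a nonnegative vector u^j with support I_j satisfying (u^j)ᵀAu^j = 0. Then the following are equivalent: (i) A is copositive; (ii) every (n−1)×(n−1) principal submatrix of A is copositive; (iii) every (n−1)×(n−1) principal submatrix of A is the sum of a positive semidefinite matrix and a symmetric matrix with nonnegative entries; (iv) the principal submatrix A_{I_j} is positive semidefinite for every j = 1,…,n, (u^n)ᵀAu^1 ≥ 0, and (u^j)ᵀAu^{j+1} ≥ 0 for j = 1,…,n−1. -/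
open Matrix

/-- A real symmetric matrix is copositive if its quadratic form is nonnegative on the
nonnegative orthant. -/
def Copositive {n : ℕ} (A : Matrix (Fin n) (Fin n) ℝ) : Prop :=
  ∀ x : Fin n → ℝ, (∀ i, 0 ≤ x i) → 0 ≤ x ⬝ᵥ A.mulVec x

/-- A copositive matrix is exceptional if it is not the sum of a positive semidefinite matrix
and a symmetric entrywise nonnegative matrix. -/
def Exceptional {n : ℕ} (A : Matrix (Fin n) (Fin n) ℝ) : Prop :=
  ¬ ∃ P N : Matrix (Fin n) (Fin n) ℝ,
      P.PosSemidef ∧ N.IsSymm ∧ (∀ i j, 0 ≤ N i j) ∧ A = P + N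

/-- A copositive matrix is extremal if in any decomposition into a sum of two copositive
matrices both summands are nonnegative multiples of it. -/
def ExtremalCopositive {n : ℕ} (A : Matrix (Fin n) (Fin n) ℝ) : Prop :=
  Copositive A ∧ ∀ A₁ A₂ : Matrix (Fin n) (Fin n) ℝ, Copositive A₁ → Copositive A₂ →
    A = A₁ + A₂ → ∃ c₁ c₂ : ℝ, 0 ≤ c₁ ∧ 0 ≤ c₂ ∧ A₁ = c₁ • A ∧ A₂ = c₂ • A

/-- A zero of a copositive matrix: a nonzero nonnegative vector on which the quadratic
form vanishes. -/
def IsZeroOf {n : ℕ} (A : Matrix (Fin n) (Fin n) ℝ) (u : Fin n → ℝ) : Prop :=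
  u ≠ 0 ∧ (∀ i, 0 ≤ u i) ∧ u ⬝ᵥ A.mulVec u = 0

/-- The support of a vector: the set of indices of its positive entries. -/
def supp {n : ℕ} (u : Fin n → ℝ) : Set (Fin n) := {i | 0 < u i}

/-- The embedding of `Fin (n-2)` into `Fin n` enumerating the cyclic index set
`I_j = {j, j+1, ..., j+(n-3)}` (0-based). -/
def circEmb (n : ℕ) (j : Fin n) : Fin (n - 2) → Fin n :=
  fun s => j + Fin.castLE (Nat.sub_le n 2) s

/-- The cyclic index set `I_j` of cardinality `n-2`. -/
def circIdx (n : ℕ) (j : Fin n) : Set (Fin n) := Set.range (circEmb n j)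

/-- The principal submatrix `A_{I_j}`. -/
def circSub {n : ℕ} (A : Matrix (Fin n) (Fin n) ℝ) (j : Fin n) :
    Matrix (Fin (n - 2)) (Fin (n - 2)) ℝ :=
  A.submatrix (circEmb n j) (circEmb n j)

/-- A minimal zero of a copositive matrix: a zero whose support does not strictly
contain the support of another zero. -/
def MinimalZero {n : ℕ} (A : Matrix (Fin n) (Fin n) ℝ) (u : Fin n → ℝ) : Prop :=
  IsZeroOf A u ∧ ∀ v, IsZeroOf A v → ¬ (supp v ⊂ supp u)

/-- The quadratic form of a matrix at a vector supported in the range of `e` is that of the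
principal submatrix indexed by `e`. -/
lemma dotProduct_submatrix_mulVec {m n : ℕ} (A : Matrix (Fin n) (Fin n) ℝ) {e : Fin m → Fin n}
    (he : Function.Injective e) {x : Fin n → ℝ} (hx : ∀ i, i ∉ Set.range e → x i = 0) :
    (x ∘ e) ⬝ᵥ (A.submatrix e e).mulVec (x ∘ e) = x ⬝ᵥ A.mulVec x := by
  simp only [dotProduct, mulVec]
  refine Fintype.sum_of_injective e he _ _ (fun i hi => by simp [hx i hi]) fun k => ?_
  simp only [Function.comp, submatrix_apply]
  congr 1
  exact Fintype.sum_of_injective e he _ _ (fun i hi => by simp [hx i hi]) fun _ => rfl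

lemma posSemidef_submatrix_iff {m n : ℕ} {A : Matrix (Fin n) (Fin n) ℝ} (hA : A.IsSymm)
    {e : Fin m → Fin n} (he : Function.Injective e) :
    (A.submatrix e e).PosSemidef ↔
      ∀ x : Fin n → ℝ, (∀ i, i ∉ Set.range e → x i = 0) → 0 ≤ x ⬝ᵥ A.mulVec x := by
  constructor
  · intro h x hx
    rw [← dotProduct_submatrix_mulVec A he hx]
    simpa using h.dotProduct_mulVec_nonneg (x ∘ e)
  · intro h
    refine PosSemidef.of_dotProduct_mulVec_nonneg ?_ fun y => ?_
    · rw [IsHermitian, conjTranspose_eq_transpose_of_trivial]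
      exact hA.submatrix e
    · have hext : ∀ i, i ∉ Set.range e → Function.extend e y 0 i = 0 :=
        fun i hi => Function.extend_apply' _ _ _ hi
      have := h _ hext
      rw [← dotProduct_submatrix_mulVec A he hext, Function.extend_comp he] at this
      simpa using this

/-- If all principal submatrices of order `n - 1` are copositive, the quadratic form is nonnegative
on the boundary of the nonnegative orthant. -/
lemma nonneg_of_forall_submatrix_copositive {n : ℕ} [NeZero n] {A : Matrix (Fin n) (Fin n) ℝ}
    (h : ∀ e : Fin (n - 1) → Fin n, Function.Injective e → Copositive (A.submatrix e e))
    {x : Fin n → ℝ} (hx : ∀ i, 0 ≤ x i) {k : Fin n} (hk : x k = 0) :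
    0 ≤ x ⬝ᵥ A.mulVec x := by
  obtain ⟨m, rfl⟩ := Nat.exists_eq_succ_of_ne_zero (NeZero.ne n)
  have hinj : Function.Injective k.succAbove := Fin.succAbove_right_injective
  rw [← dotProduct_submatrix_mulVec A hinj]
  · exact h k.succAbove hinj _ fun i => hx _
  · intro i hi
    rw [Fin.range_succAbove] at hi
    rw [show i = k by simpa using hi, hk]

lemma dotProduct_mulVec_symm {n : ℕ} {A : Matrix (Fin n) (Fin n) ℝ} (hA : A.IsSymm)
    (x y : Fin n → ℝ) : x ⬝ᵥ A.mulVec y = y ⬝ᵥ A.mulVec x := by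
  rw [dotProduct_mulVec, ← mulVec_transpose, hA.eq, dotProduct_comm]

lemma quadForm_add_smul {n : ℕ} {A : Matrix (Fin n) (Fin n) ℝ} (hA : A.IsSymm)
    (x y : Fin n → ℝ) (t : ℝ) :
    (x + t • y) ⬝ᵥ A.mulVec (x + t • y) =
      x ⬝ᵥ A.mulVec x + 2 * t * (x ⬝ᵥ A.mulVec y) + t ^ 2 * (y ⬝ᵥ A.mulVec y) := by
  simp only [mulVec_add, mulVec_smul, dotProduct_add, add_dotProduct, smul_dotProduct,
    dotProduct_smul, smul_eq_mul, dotProduct_mulVec_symm hA y x]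
  ring

/-- First-order optimality condition at a zero of the quadratic form. -/
lemma nonneg_dotProduct_mulVec_of_zero {n : ℕ} {A : Matrix (Fin n) (Fin n) ℝ} (hA : A.IsSymm)
    {u v : Fin n → ℝ} (hu : u ⬝ᵥ A.mulVec u = 0) {r : ℝ} (hr : 0 < r)
    (h : ∀ t : ℝ, 0 < t → t ≤ r → 0 ≤ (u + t • v) ⬝ᵥ A.mulVec (u + t • v)) :
    0 ≤ u ⬝ᵥ A.mulVec v := by
  by_contra! hneg
  set b := u ⬝ᵥ A.mulVec v
  set c := v ⬝ᵥ A.mulVec v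
  have hc : 0 < |c| + 1 := by positivity
  have hd : 0 < -b / (|c| + 1) := div_pos (by linarith) hc
  have ht : 0 < min r (-b / (|c| + 1)) := lt_min hr hd
  have key := h _ ht (min_le_left _ _)
  rw [quadForm_add_smul hA, hu] at key
  have hle := (le_div_iff₀ hc).1 (min_le_right r (-b / (|c| + 1)))
  set t := min r (-b / (|c| + 1))
  have h1 : 0 ≤ 2 * b + t * c := by
    by_contra! hlt
    nlinarith [mul_pos_of_neg_of_neg hlt (neg_neg_of_pos ht)]
  nlinarith [mul_le_mul_of_nonneg_left (le_abs_self c) ht.le]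

lemma dotProduct_mulVec_single {n : ℕ} {A : Matrix (Fin n) (Fin n) ℝ} (hA : A.IsSymm)
    (u : Fin n → ℝ) (i : Fin n) (c : ℝ) :
    u ⬝ᵥ A.mulVec (Pi.single i c) = c * A.mulVec u i := by
  rw [dotProduct_mulVec_symm hA, single_dotProduct]

lemma mem_circIdx_iff {n : ℕ} [NeZero n] (hn : 5 ≤ n) (i j : Fin n) :
    i ∈ circIdx n j ↔ i ≠ j - 1 ∧ i ≠ j - 1 - 1 := by
  have hval : i ∈ circIdx n j ↔ (i - j).val < n - 2 := by
    constructor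
    · rintro ⟨s, rfl⟩
      simp [circEmb]
    · intro h
      exact ⟨⟨_, h⟩, by simp [circEmb]⟩
  have h1 : (-1 : Fin n).val = n - 1 := by
    obtain ⟨m, rfl⟩ : ∃ m, n = m + 1 := ⟨n - 1, by omega⟩
    exact Fin.coe_neg_one
  have h2 : (-1 - 1 : Fin n).val = n - 2 := by
    rw [Fin.sub_val_of_le, h1, Fin.val_one', Nat.mod_eq_of_lt (by omega)]
    · omega
    · rw [Fin.le_def, h1, Fin.val_one', Nat.mod_eq_of_lt (by omega)]; omega
  have e1 : i = j - 1 ↔ (i - j).val = n - 1 := by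
    rw [← h1, Fin.val_inj, sub_eq_iff_eq_add]
    constructor <;> (rintro rfl; abel)
  have e2 : i = j - 1 - 1 ↔ (i - j).val = n - 2 := by
    rw [← h2, Fin.val_inj, sub_eq_iff_eq_add]
    constructor <;> (rintro rfl; abel)
  rw [hval, Ne, Ne, e1, e2]
  have := (i - j).isLt
  omega

lemma circEmb_injective (n : ℕ) [NeZero n] (j : Fin n) : Function.Injective (circEmb n j) :=
  fun _ _ h => Fin.castLE_injective _ (add_left_cancel h)

/-- Let the form `A` be nonnegative on the vectors vanishing at `k` and `j`, and let `u` be a vector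
vanishing at `k` and `l` which `A` annihilates away from `k` and `l`. If `u` has nonnegative mixed
value with some `v`, then on the vectors vanishing at `k` the form splits into a positive
semidefinite and an entrywise nonnegative part, the latter concentrated at the entry `(j, l)`. -/
lemma exists_corner_split {n : ℕ} {A : Matrix (Fin n) (Fin n) ℝ} (hA : A.IsSymm)
    {u v : Fin n → ℝ} {j l k : Fin n} (huk : u k = 0) (hul : u l = 0) (huj : 0 < u j)
    (hvl : 0 < v l) (hvk : v k = 0) (hAu : ∀ i, i ≠ k → i ≠ l → A.mulVec u i = 0)
    (huv : 0 ≤ u ⬝ᵥ A.mulVec v)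
    (hpsd : ∀ x : Fin n → ℝ, x k = 0 → x j = 0 → 0 ≤ x ⬝ᵥ A.mulVec x) :
    ∃ N : Matrix (Fin n) (Fin n) ℝ, N.IsSymm ∧ (∀ a b, 0 ≤ N a b) ∧
      ∀ x : Fin n → ℝ, x k = 0 → 0 ≤ x ⬝ᵥ (A - N).mulVec x := by
  have hdot : ∀ x : Fin n → ℝ, x k = 0 → x ⬝ᵥ A.mulVec u = x l * A.mulVec u l := by
    intro x hx
    refine Finset.sum_eq_single l (fun i _ hil => ?_) (by simp)
    by_cases hik : i = k
    · simp [hik, hx]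
    · simp [hAu i hik hil]
  have hrow : 0 ≤ A.mulVec u l := by
    rw [dotProduct_mulVec_symm hA, hdot v hvk] at huv
    exact nonneg_of_mul_nonneg_right huv hvl
  set d := A.mulVec u l / u j
  have hd : 0 ≤ d := div_nonneg hrow huj.le
  have hdu : d * u j = A.mulVec u l := div_mul_cancel₀ _ huj.ne'
  set N : Matrix (Fin n) (Fin n) ℝ := Matrix.single j l d + Matrix.single l j d
  have hNsymm : N.IsSymm := by
    simp [N, IsSymm, transpose_add, add_comm]
  have hN : ∀ x y : Fin n → ℝ, x ⬝ᵥ N.mulVec y = d * (x j * y l + x l * y j) := by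
    intro x y
    simp only [N, add_mulVec, dotProduct_add]
    rw [single_mulVec, single_mulVec, ← Pi.single, ← Pi.single, dotProduct_single,
      dotProduct_single]
    ring
  refine ⟨N, hNsymm, fun a b => ?_, fun x hx => ?_⟩
  · simp only [N, Matrix.add_apply, single_apply]
    split_ifs <;> positivity
  · set y := x + (-(x j / u j)) • u with hy
    have hyk : y k = 0 := by simp [hy, hx, huk]
    have hyj : y j = 0 := by simp [hy, huj.ne']
    have hxy : x = y + (x j / u j) • u := by simp [hy]
    have hB : (A - N).IsSymm := hA.sub hNsymm
    rw [hxy, quadForm_add_smul hB]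
    simp only [sub_mulVec, dotProduct_sub, hN, hdot y hyk, hdot u huk, hul, hyj, ← hdu]
    have := hpsd y hyk hyj
    linarith

lemma submatrix_copositive {n m : ℕ} {A : Matrix (Fin n) (Fin n) ℝ} (hA : Copositive A)
    {e : Fin m → Fin n} (he : Function.Injective e) : Copositive (A.submatrix e e) := by
  intro y hy
  have hext : ∀ i, i ∉ Set.range e → Function.extend e y 0 i = 0 :=
    fun i hi => Function.extend_apply' _ _ _ hi
  have key := dotProduct_submatrix_mulVec A he hext
  rw [Function.extend_comp he] at key
  rw [key]
  refine hA _ fun i => ?_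
  by_cases hi : i ∈ Set.range e
  · obtain ⟨k, rfl⟩ := hi
    rw [he.extend_apply]
    exact hy k
  · rw [hext i hi]

lemma copositive_of_posSemidef_add_nonneg {m : ℕ} {P N : Matrix (Fin m) (Fin m) ℝ}
    (hP : P.PosSemidef) (hN : ∀ i k, 0 ≤ N i k) : Copositive (P + N) := by
  intro x hx
  rw [add_mulVec, dotProduct_add]
  refine add_nonneg (by simpa using hP.dotProduct_mulVec_nonneg x) ?_
  refine Finset.sum_nonneg fun i _ => mul_nonneg (hx i) ?_
  rw [mulVec, dotProduct]
  exact Finset.sum_nonneg fun k _ => mul_nonneg (hN i k) (hx k)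

/-- Copositivity from nonnegativity on the boundary of the orthant, given a nonzero nonnegative
zero `u` with `A u ≥ 0`: an interior point is moved to the boundary along `-u`. -/
lemma copositive_of_boundary {n : ℕ} {A : Matrix (Fin n) (Fin n) ℝ} (hA : A.IsSymm)
    {u : Fin n → ℝ} (hu : ∀ i, 0 ≤ u i) {j : Fin n} (huj : 0 < u j) (hzero : u ⬝ᵥ A.mulVec u = 0)
    (hAu : ∀ i, 0 ≤ A.mulVec u i)
    (hbd : ∀ x : Fin n → ℝ, (∀ i, 0 ≤ x i) → ∀ k, x k = 0 → 0 ≤ x ⬝ᵥ A.mulVec x) :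
    Copositive A := by
  intro x hx
  obtain ⟨k, hk, hmin⟩ := (Finset.univ.filter fun i => 0 < u i).exists_min_image
    (fun i => x i / u i) ⟨j, by simpa using huj⟩
  simp only [Finset.mem_filter, Finset.mem_univ, true_and] at hk hmin
  set t := x k / u k
  have ht : 0 ≤ t := div_nonneg (hx k) hk.le
  set y := x + (-t) • u with hy
  have hy0 : ∀ i, 0 ≤ y i := by
    intro i
    rcases (hu i).eq_or_lt with h | h
    · simp [hy, ← h, hx i]
    · have := (le_div_iff₀ h).1 (hmin i h)
      simp only [hy, Pi.add_apply, Pi.smul_apply, smul_eq_mul]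
      linarith
  have hyk : y k = 0 := by simp [hy, t, hk.ne']
  have hxy : x = y + t • u := by simp [hy]
  rw [hxy, quadForm_add_smul hA, hzero]
  have h1 := hbd y hy0 k hyk
  have h2 : 0 ≤ y ⬝ᵥ A.mulVec u := Finset.sum_nonneg fun i _ => mul_nonneg (hy0 i) (hAu i)
  have := mul_nonneg ht h2
  linarith

/-- A form that is nonnegative on the nonnegative vectors supported in the support of a zero `u`
is nonnegative on all vectors supported there. -/
lemma nonneg_of_support_subset {n : ℕ} {A : Matrix (Fin n) (Fin n) ℝ} (hA : A.IsSymm)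
    {u : Fin n → ℝ} (hu : ∀ i, 0 ≤ u i) (hzero : u ⬝ᵥ A.mulVec u = 0)
    (hAu : ∀ i, 0 < u i → A.mulVec u i = 0) {k : Fin n} (huk : ¬ 0 < u k)
    (hbd : ∀ x : Fin n → ℝ, (∀ i, 0 ≤ x i) → x k = 0 → 0 ≤ x ⬝ᵥ A.mulVec x)
    {x : Fin n → ℝ} (hx : ∀ i, ¬ 0 < u i → x i = 0) : 0 ≤ x ⬝ᵥ A.mulVec x := by
  set t := ∑ i, |x i| / u i
  have hxu : x ⬝ᵥ A.mulVec u = 0 := Finset.sum_eq_zero fun i _ => by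
    by_cases h : 0 < u i
    · simp [hAu i h]
    · simp [hx i h]
  have hk : u k = 0 := le_antisymm (not_lt.1 huk) (hu k)
  have key := hbd (x + t • u) (fun i => ?_) (by simp [hx k huk, hk])
  · rw [quadForm_add_smul hA, hxu, hzero] at key
    simpa using key
  · by_cases h : 0 < u i
    · have h1 : |x i| / u i ≤ t := Finset.single_le_sum (f := fun i => |x i| / u i)
        (fun i _ => div_nonneg (abs_nonneg _) (hu i)) (Finset.mem_univ i)
      have h2 := (div_le_iff₀ h).1 h1
      have h3 := neg_abs_le (x i)
      simp only [Pi.add_apply, Pi.smul_apply, smul_eq_mul]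
      linarith
    · simp [hx i h, le_antisymm (not_lt.1 h) (hu i)]

/-- At a zero of a form that is nonnegative on the boundary of the orthant, if two coordinates of
the zero vanish then `A u ≥ 0`, with equality on the support. -/
lemma mulVec_nonneg_of_boundary {n : ℕ} {A : Matrix (Fin n) (Fin n) ℝ} (hA : A.IsSymm)
    {u : Fin n → ℝ} (hu : ∀ i, 0 ≤ u i) (hzero : u ⬝ᵥ A.mulVec u = 0)
    {k l : Fin n} (hkl : k ≠ l) (hk : u k = 0) (hl : u l = 0)
    (hbd : ∀ x : Fin n → ℝ, (∀ i, 0 ≤ x i) → ∀ k, x k = 0 → 0 ≤ x ⬝ᵥ A.mulVec x) :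
    (∀ i, 0 ≤ A.mulVec u i) ∧ ∀ i, 0 < u i → A.mulVec u i = 0 := by
  have hnonneg : ∀ i, 0 ≤ A.mulVec u i := by
    intro i
    obtain ⟨m, hmi, hm⟩ : ∃ m, m ≠ i ∧ u m = 0 := by
      by_cases h : k = i
      · exact ⟨l, fun h' => hkl (h.trans h'.symm), hl⟩
      · exact ⟨k, h, hk⟩
    have := nonneg_dotProduct_mulVec_of_zero hA (v := Pi.single i 1) hzero one_pos
      fun t ht _ => hbd _ (fun a => add_nonneg (hu a) (mul_nonneg ht.le
        (by by_cases h : a = i <;> simp [h]))) m (by simp [hmi, hm])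
    rwa [dotProduct_mulVec_single hA, one_mul] at this
  refine ⟨hnonneg, fun i hi => le_antisymm ?_ (hnonneg i)⟩
  have hki : k ≠ i := fun h => hi.ne' (h ▸ hk)
  have := nonneg_dotProduct_mulVec_of_zero hA (v := Pi.single i (-1)) hzero hi
    fun t ht hti => hbd _ (fun a => by
      by_cases h : a = i
      · subst h
        simpa using hti
      · simpa [h] using hu a) k (by simp [hki, hk])
  rw [dotProduct_mulVec_single hA] at this
  linarith

/-- A zero of a form which is nonnegative on the vectors vanishing off a set `S` containing its
support lies in the kernel of the form restricted to `S`. -/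
lemma mulVec_eq_zero_of_nonneg_on {n : ℕ} {A : Matrix (Fin n) (Fin n) ℝ} (hA : A.IsSymm)
    {u : Fin n → ℝ} (hzero : u ⬝ᵥ A.mulVec u = 0) {S : Set (Fin n)} (hS : ∀ i, i ∉ S → u i = 0)
    (h : ∀ x : Fin n → ℝ, (∀ i, i ∉ S → x i = 0) → 0 ≤ x ⬝ᵥ A.mulVec x)
    {i : Fin n} (hi : i ∈ S) : A.mulVec u i = 0 := by
  have key : ∀ c : ℝ, 0 ≤ c * A.mulVec u i := by
    intro c
    rw [← dotProduct_mulVec_single hA]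
    refine nonneg_dotProduct_mulVec_of_zero hA hzero one_pos fun t _ _ => h _ fun a ha => ?_
    have : a ≠ i := fun h => ha (h ▸ hi)
    simp [this, hS a ha]
  linarith [key 1, key (-1)]

theorem statement0 (n : ℕ) [NeZero n] (hn : 5 ≤ n) (A : Matrix (Fin n) (Fin n) ℝ) (hA : A.IsSymm)
    (u : Fin n → Fin n → ℝ)
    (hnn : ∀ j i, 0 ≤ u j i)
    (hsupp : ∀ j, supp (u j) = circIdx n j)
    (hzero : ∀ j, u j ⬝ᵥ A.mulVec (u j) = 0) :
    List.TFAE [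
      Copositive A,
      ∀ e : Fin (n - 1) → Fin n, Function.Injective e → Copositive (A.submatrix e e),
      ∀ e : Fin (n - 1) → Fin n, Function.Injective e →
        ∃ P N : Matrix (Fin (n - 1)) (Fin (n - 1)) ℝ,
          P.PosSemidef ∧ N.IsSymm ∧ (∀ i k, 0 ≤ N i k) ∧ A.submatrix e e = P + N,
      (∀ j : Fin n, (circSub A j).PosSemidef) ∧
        ∀ j : Fin n, 0 ≤ u j ⬝ᵥ A.mulVec (u (j + 1))
    ] := by
  have hpos : ∀ j i, 0 < u j i ↔ i ≠ j - 1 ∧ i ≠ j - 1 - 1 := fun j i => by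
    rw [← mem_circIdx_iff hn, ← hsupp]; rfl
  have hmem : ∀ j i, i ∈ Set.range (circEmb n j) ↔ 0 < u j i := fun j i => by
    rw [← circIdx, ← hsupp]; rfl
  have hzer : ∀ j i, ¬ 0 < u j i → u j i = 0 := fun j i h => le_antisymm (not_lt.1 h) (hnn j i)
  have hone : (1 : Fin n) ≠ 0 := by
    rw [Ne, ← Fin.val_inj, Fin.val_one', Nat.mod_eq_of_lt (by omega)]; simp
  have htwo : (1 + 1 : Fin n) ≠ 0 := by
    rw [Ne, ← Fin.val_inj, Fin.val_add, Fin.val_one', Nat.mod_eq_of_lt (by omega : 1 < n),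
      Nat.mod_eq_of_lt (by omega)]
    simp
  have hz1 : ∀ j, u j (j - 1) = 0 := fun j => hzer _ _ fun h => ((hpos _ _).1 h).1 rfl
  have hz2 : ∀ j, u j (j - 1 - 1) = 0 := fun j => hzer _ _ fun h => ((hpos _ _).1 h).2 rfl
  have hne : ∀ k : Fin n, k ≠ k - 1 := fun k h => hone (by rwa [eq_comm, sub_eq_self] at h)
  have hne2 : ∀ k : Fin n, k ≠ k - 1 - 1 := fun k h =>
    htwo (by rwa [sub_sub, eq_comm, sub_eq_self] at h)
  tfae_have 1 → 2 := fun h e he => submatrix_copositive h he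
  tfae_have 3 → 2 := by
    intro h e he
    obtain ⟨P, N, hP, -, hN, heq⟩ := h e he
    rw [heq]
    exact copositive_of_posSemidef_add_nonneg hP hN
  tfae_have 2 → 1 := by
    intro h
    have hbd := fun x hx k hk => nonneg_of_forall_submatrix_copositive h (x := x) hx (k := k) hk
    exact copositive_of_boundary hA (hnn 0) ((hpos 0 0).2 ⟨hne 0, hne2 0⟩) (hzero 0)
      (mulVec_nonneg_of_boundary hA (hnn 0) (hzero 0) (hne _) (hz1 0) (hz2 0) hbd).1 hbd
  tfae_have 2 → 4 := by
    intro h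
    have hbd := fun x hx k hk => nonneg_of_forall_submatrix_copositive h (x := x) hx (k := k) hk
    have hAu := fun j =>
      mulVec_nonneg_of_boundary hA (hnn j) (hzero j) (hne _) (hz1 j) (hz2 j) hbd
    refine ⟨fun j => ?_, fun j => ?_⟩
    · rw [circSub, posSemidef_submatrix_iff hA (circEmb_injective n j)]
      intro x hx
      exact nonneg_of_support_subset hA (hnn j) (hzero j) (hAu j).2 (hz1 j).not_gt
        (fun x hx hk => hbd x hx _ hk) fun i hi => hx i ((hmem j i).not.2 hi)
    · exact Finset.sum_nonneg fun i _ => mul_nonneg (hnn j i) ((hAu (j + 1)).1 i)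
  tfae_have 4 → 3 := by
    rintro ⟨hpsd, hmix⟩ e he
    obtain ⟨k, hk⟩ : ∃ k, k ∉ Set.range e := by
      by_contra! hsurj
      have := Fintype.card_le_of_surjective e hsurj
      simp only [Fintype.card_fin] at this
      omega
    have hq : ∀ (j : Fin n) (x : Fin n → ℝ), x (j - 1) = 0 → x (j - 1 - 1) = 0 →
        0 ≤ x ⬝ᵥ A.mulVec x := by
      intro j x h1 h2
      refine (posSemidef_submatrix_iff hA (circEmb_injective n j)).1 (hpsd j) x fun i hi => ?_
      rw [hmem, hpos, not_and_or, not_not, not_not] at hi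
      rcases hi with rfl | rfl <;> assumption
    have hker : ∀ j i, 0 < u j i → A.mulVec (u j) i = 0 := fun j i hi =>
      mulVec_eq_zero_of_nonneg_on hA (hzero j) (S := {i | 0 < u j i}) (fun i hi => hzer j i hi)
        (fun x hx => hq j x (hx _ (hz1 j).not_gt) (hx _ (hz2 j).not_gt)) hi
    have hk1 : k + 1 - 1 = k := add_sub_cancel_right k 1
    have hk2 : k + 1 + 1 - 1 = k + 1 := add_sub_cancel_right _ 1
    obtain ⟨N, hNs, hN0, hN⟩ := exists_corner_split hA (u := u (k + 1)) (v := u (k + 1 + 1))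
      (j := k + 1) (l := k - 1) (k := k)
      (by simpa [hk1] using hz1 (k + 1)) (by simpa [hk1] using hz2 (k + 1))
      ((hpos _ _).2 ⟨hne _, hne2 _⟩)
      ((hpos _ _).2 (by
        rw [hk2, hk1]
        exact ⟨by simpa [hk1] using (hne2 (k + 1)).symm, (hne k).symm⟩))
      (by simpa [hk2, hk1] using hz2 (k + 1 + 1))
      (fun i hi hi' => hker _ _ ((hpos _ _).2 (by rw [hk1]; exact ⟨hi, hi'⟩)))
      (hmix _)
      (fun x hx hx' => hq (k + 1 + 1) x (by rwa [hk2]) (by rwa [hk2, hk1]))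
    refine ⟨(A - N).submatrix e e, N.submatrix e e,
      (posSemidef_submatrix_iff (hA.sub hNs) he).2 fun x hx => hN x (hx k hk),
      hNs.submatrix e, fun i j => hN0 _ _, ?_⟩
    ext i j
    simp
  tfae_finish
end

section
/- Let n ≥ 5 and let A be a copositive real symmetric n×n matrix such that for every j = 1,…,n there exists a nonnegative vector u^j with support I_j satisfying (u^j)ᵀAu^j = 0. Then the following are equivalent: (a) A is positive semidefinite; (b) at least one of the n numbers (u^n)ᵀAu^1 and (u^j)ᵀAu^{j+1}, j = 1,…,n−1, is zero; (c) all n numbers (u^n)ᵀAu^1 and (u^j)ᵀAu^{j+1}, j = 1,…,n−1, are zero; (d) A can be written as P + N with P positive semidefinite and N a symmetric matrix with nonnegative entries. -/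
open Matrix

open Fin.CommRing in
/-- An index belongs to the cyclic index set `I_j` as soon as it is neither of the two
indices preceding `j`. -/
lemma mem_circIdx_of_ne {n : ℕ} [NeZero n] (hn : 2 ≤ n) {i j : Fin n}
    (h1 : j ≠ i + 1) (h2 : j ≠ i + 2) : i ∈ circIdx n j := by
  have hj : j + (i - j) = i := add_sub_cancel j i
  have key : ∀ t : Fin n, t + 1 ≠ 0 → t + 2 ≠ 0 → t.val < n - 2 := by
    intro t ht1 ht2
    by_contra hlt
    have ht := t.isLt
    obtain h | h : t.val = n - 1 ∨ t.val = n - 2 := by omega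
    · apply ht1
      have ht' : t = ((n - 1 : ℕ) : Fin n) := by rw [← h, Fin.cast_val_eq_self]
      rw [ht', ← Nat.cast_succ, Nat.succ_eq_add_one, Nat.sub_add_cancel (by omega),
        Fin.natCast_self]
    · apply ht2
      have ht' : t = ((n - 2 : ℕ) : Fin n) := by rw [← h, Fin.cast_val_eq_self]
      have h2 : (2 : Fin n) = ((2 : ℕ) : Fin n) := rfl
      rw [ht', h2, ← Nat.cast_add, Nat.sub_add_cancel hn, Fin.natCast_self]
  have hlt : (i - j).val < n - 2 := by
    apply key
    · intro h
      apply h1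
      rw [← sub_eq_zero, ← neg_eq_zero, ← h]
      abel
    · intro h
      apply h2
      rw [← sub_eq_zero, ← neg_eq_zero, ← h]
      abel
  exact ⟨⟨(i - j).val, hlt⟩, hj⟩

open Fin.NatCast in
lemma Fin.natCast_ne_zero_of_lt {n k : ℕ} [NeZero n] (hk : 0 < k) (hkn : k < n) :
    (k : Fin n) ≠ 0 := by
  intro h
  have := congrArg Fin.val h
  rw [Fin.val_natCast, Nat.mod_eq_of_lt hkn, Fin.val_zero] at this
  omega

lemma Matrix.IsSymm.dotProduct_mulVec_comm {ι : Type*} [Fintype ι] {A : Matrix ι ι ℝ}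
    (hA : A.IsSymm) (x y : ι → ℝ) : x ⬝ᵥ A *ᵥ y = y ⬝ᵥ A *ᵥ x := by
  rw [dotProduct_mulVec, ← mulVec_transpose, hA.eq, dotProduct_comm]

lemma Matrix.IsSymm.dotProduct_mulVec_smul_add_smul {ι : Type*} [Fintype ι]
    {A : Matrix ι ι ℝ} (hA : A.IsSymm) (a b : ℝ) (x y : ι → ℝ) :
    (a • x + b • y) ⬝ᵥ A *ᵥ (a • x + b • y) =
      a ^ 2 * (x ⬝ᵥ A *ᵥ x) + 2 * (a * b) * (x ⬝ᵥ A *ᵥ y) + b ^ 2 * (y ⬝ᵥ A *ᵥ y) := by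
  simp only [mulVec_add, mulVec_smul, add_dotProduct, dotProduct_add, smul_dotProduct,
    dotProduct_smul, smul_eq_mul, hA.dotProduct_mulVec_comm y x]
  ring

lemma Matrix.IsSymm.dotProduct_mulVec_add {ι : Type*} [Fintype ι]
    {A : Matrix ι ι ℝ} (hA : A.IsSymm) (x y : ι → ℝ) :
    (x + y) ⬝ᵥ A *ᵥ (x + y) =
      x ⬝ᵥ A *ᵥ x + 2 * (x ⬝ᵥ A *ᵥ y) + y ⬝ᵥ A *ᵥ y := by
  simpa using hA.dotProduct_mulVec_smul_add_smul 1 1 x y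

/-- A nonnegative vector dominates a small multiple of any vector vanishing off its
support. -/
lemma exists_pos_mul_abs_le {ι : Type*} [Finite ι] {x y : ι → ℝ} (hx : ∀ i, 0 ≤ x i)
    (hxy : ∀ i, y i ≠ 0 → 0 < x i) : ∃ ε : ℝ, 0 < ε ∧ ∀ i, ε * |y i| ≤ x i := by
  have hev : ∀ᶠ ε : ℝ in nhdsWithin 0 (Set.Ioi 0), ∀ i, ε * |y i| ≤ x i := by
    rw [Filter.eventually_all]
    intro i
    by_cases hy : y i = 0
    · simp [hy, hx i]
    · have hcont : ContinuousAt (fun ε : ℝ => ε * |y i|) 0 := by fun_prop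
      refine Filter.Eventually.filter_mono nhdsWithin_le_nhds ?_
      refine (hcont.eventually_lt_const (u := x i) (by simpa using hxy i hy)).mono ?_
      exact fun ε h => h.le
  obtain ⟨ε, h, hε⟩ := (hev.and self_mem_nhdsWithin).exists
  exact ⟨ε, hε, h⟩

/-- The quadratic form of a copositive matrix is nonnegative on all vectors vanishing off the
support of one of its zeros. -/
lemma Copositive.nonneg_of_zero {n : ℕ} {A : Matrix (Fin n) (Fin n) ℝ} (hA : A.IsSymm)
    (hcop : Copositive A) {x y : Fin n → ℝ} (hx : ∀ i, 0 ≤ x i)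
    (hx0 : x ⬝ᵥ A *ᵥ x = 0) (hxy : ∀ i, y i ≠ 0 → 0 < x i) : 0 ≤ y ⬝ᵥ A *ᵥ y := by
  obtain ⟨ε, hε, hle⟩ := exists_pos_mul_abs_le hx hxy
  have hplus := hcop ((1 : ℝ) • x + ε • y) fun i => by
    have := mul_le_mul_of_nonneg_left (neg_abs_le (y i)) hε.le
    simp only [Pi.add_apply, Pi.smul_apply, smul_eq_mul]
    linarith [hle i]
  have hminus := hcop ((1 : ℝ) • x + (-ε) • y) fun i => by
    have := mul_le_mul_of_nonneg_left (le_abs_self (y i)) hε.le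
    simp only [Pi.add_apply, Pi.smul_apply, smul_eq_mul]
    linarith [hle i]
  rw [hA.dotProduct_mulVec_smul_add_smul, hx0] at hplus hminus
  have : 0 ≤ ε ^ 2 * (y ⬝ᵥ A *ᵥ y) := by linarith
  exact nonneg_of_mul_nonneg_right this (by positivity)

/-- A copositive matrix having a zero with full support is positive semidefinite. -/
lemma Copositive.posSemidef_of_zero {n : ℕ} {A : Matrix (Fin n) (Fin n) ℝ} (hA : A.IsSymm)
    (hcop : Copositive A) {x : Fin n → ℝ} (hx : ∀ i, 0 < x i) (hx0 : x ⬝ᵥ A *ᵥ x = 0) :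
    A.PosSemidef := by
  refine PosSemidef.of_dotProduct_mulVec_nonneg ?_ fun y => ?_
  · rw [IsHermitian, conjTranspose_eq_transpose_of_trivial, hA.eq]
  · simpa using hcop.nonneg_of_zero hA (fun i => (hx i).le) hx0 fun i _ => hx i

/-- If a zero of a copositive matrix is positive away from the index `p`, then any two zeros
that are positive at `p` are orthogonal with respect to the matrix. -/
lemma Copositive.dotProduct_mulVec_eq_zero {n : ℕ} {A : Matrix (Fin n) (Fin n) ℝ}
    (hA : A.IsSymm) (hcop : Copositive A) {s x y : Fin n → ℝ} {p : Fin n}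
    (hs : ∀ i, 0 ≤ s i) (hs0 : s ⬝ᵥ A *ᵥ s = 0) (hsp : ∀ i, i ≠ p → 0 < s i)
    (hx : ∀ i, 0 ≤ x i) (hx0 : x ⬝ᵥ A *ᵥ x = 0) (hxp : 0 < x p)
    (hy : ∀ i, 0 ≤ y i) (hy0 : y ⬝ᵥ A *ᵥ y = 0) (hyp : 0 < y p) :
    x ⬝ᵥ A *ᵥ y = 0 := by
  have hge := hcop (x + y) fun i => add_nonneg (hx i) (hy i)
  rw [hA.dotProduct_mulVec_add, hx0, hy0] at hge
  have hd := hcop.nonneg_of_zero hA (y := y p • x + (-x p) • y) hs hs0 fun i hi => by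
    refine hsp i ?_
    rintro rfl
    exact hi (by simp only [Pi.add_apply, Pi.smul_apply, smul_eq_mul]; ring)
  rw [hA.dotProduct_mulVec_smul_add_smul, hx0, hy0] at hd
  nlinarith [mul_pos hxp hyp]

/-- A matrix with nonnegative entries vanishes on the support of any nonnegative vector at
which its quadratic form is nonpositive. -/
lemma Matrix.apply_eq_zero_of_dotProduct_mulVec_nonpos {ι : Type*} [Fintype ι]
    {N : Matrix ι ι ℝ} (hN : ∀ i k, 0 ≤ N i k) {x : ι → ℝ} (hx : ∀ i, 0 ≤ x i)
    (hx0 : x ⬝ᵥ N *ᵥ x ≤ 0) {i k : ι} (hi : 0 < x i) (hk : 0 < x k) : N i k = 0 := by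
  have hNx : ∀ i, 0 ≤ (N *ᵥ x) i := fun i =>
    Finset.sum_nonneg fun k _ => mul_nonneg (hN i k) (hx k)
  have h1 : x i * (N *ᵥ x) i ≤ x ⬝ᵥ N *ᵥ x :=
    Finset.single_le_sum (f := fun i => x i * (N *ᵥ x) i)
      (fun i _ => mul_nonneg (hx i) (hNx i)) (Finset.mem_univ i)
  have h2 : N i k * x k ≤ (N *ᵥ x) i :=
    Finset.single_le_sum (f := fun k => N i k * x k)
      (fun k _ => mul_nonneg (hN i k) (hx k)) (Finset.mem_univ k)
  have h3 : x i * (N i k * x k) ≤ 0 := (mul_le_mul_of_nonneg_left h2 hi.le).trans (h1.trans hx0)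
  have h4 : 0 < x i * x k := mul_pos hi hk
  refine le_antisymm ?_ (hN i k)
  by_contra! hpos
  nlinarith [mul_pos hpos h4]

/-- For `n ≥ 5` any two indices lie in a common cyclic index set `I_j`. -/
lemma exists_mem_circIdx {n : ℕ} [NeZero n] (hn : 5 ≤ n) (i k : Fin n) :
    ∃ j, i ∈ circIdx n j ∧ k ∈ circIdx n j := by
  have hcard : ({i + 1, i + 2, k + 1, k + 2} : Finset (Fin n)).card <
      (Finset.univ : Finset (Fin n)).card := by
    rw [Finset.card_univ, Fintype.card_fin]
    exact Finset.card_le_four.trans_lt (by omega)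
  obtain ⟨j, -, hj⟩ := Finset.exists_mem_notMem_of_card_lt_card hcard
  simp only [Finset.mem_insert, Finset.mem_singleton, not_or] at hj
  exact ⟨j, mem_circIdx_of_ne (by omega) hj.1 hj.2.1,
    mem_circIdx_of_ne (by omega) hj.2.2.1 hj.2.2.2⟩

open Fin.CommRing in
theorem posSemidef_of_exists_dotProduct_mulVec_eq_zero {n : ℕ} [NeZero n] (hn : 5 ≤ n)
    {A : Matrix (Fin n) (Fin n) ℝ} (hA : A.IsSymm) (hcop : Copositive A)
    {u : Fin n → Fin n → ℝ} (hnn : ∀ j i, 0 ≤ u j i)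
    (hpos : ∀ i j, j ≠ i + 1 → j ≠ i + 2 → 0 < u j i)
    (hzero : ∀ j, u j ⬝ᵥ A *ᵥ u j = 0)
    {j : Fin n} (hj : u j ⬝ᵥ A *ᵥ u (j + 1) = 0) : A.PosSemidef := by
  have e1 : (1 : Fin n) ≠ 0 := by
    simpa using Fin.natCast_ne_zero_of_lt (n := n) (k := 1) (by omega) (by omega)
  have e2 : (2 : Fin n) ≠ 0 := Fin.natCast_ne_zero_of_lt (k := 2) (by omega) (by omega)
  have e3 : (3 : Fin n) ≠ 0 := Fin.natCast_ne_zero_of_lt (k := 3) (by omega) (by omega)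
  have e4 : (4 : Fin n) ≠ 0 := Fin.natCast_ne_zero_of_lt (k := 4) (by omega) (by omega)
  have hadd : ∀ k l i, 0 < u k i ∨ 0 < u l i → 0 < (u k + u l) i := by
    rintro k l i (h | h)
    · exact add_pos_of_pos_of_nonneg h (hnn l i)
    · exact add_pos_of_nonneg_of_pos (hnn k i) h
  have hor : ∀ k l i, ¬((k = i + 1 ∨ k = i + 2) ∧ (l = i + 1 ∨ l = i + 2)) →
      0 < (u k + u l) i := by
    intro k l i h
    apply hadd
    have hk := hpos i k
    have hl := hpos i l
    tauto
  have hxy : u (j + 2) ⬝ᵥ A *ᵥ u (j + 4) = 0 := by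
    refine hcop.dotProduct_mulVec_eq_zero hA (s := u j + u (j + 1)) (p := j - 1)
      (fun i => add_nonneg (hnn _ i) (hnn _ i)) ?_ (fun i hi => hor _ _ _ ?_)
      (hnn _) (hzero _) (hpos _ _ ?_ ?_) (hnn _) (hzero _) (hpos _ _ ?_ ?_)
    · rw [hA.dotProduct_mulVec_add, hzero, hzero, hj]
      ring
    · rintro ⟨h | h, h' | h'⟩
      · exact e1 (by linear_combination h' - h)
      · exact hi (by linear_combination -h')
      · exact e2 (by linear_combination h' - h)
      · exact hi (by linear_combination -h')
    · exact fun h => e2 (by linear_combination h)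
    · exact fun h => e1 (by linear_combination h)
    · exact fun h => e4 (by linear_combination h)
    · exact fun h => e3 (by linear_combination h)
  refine hcop.posSemidef_of_zero hA (x := u (j + 2) + u (j + 4)) (fun i => hor _ _ _ ?_) ?_
  · rintro ⟨h | h, h' | h'⟩
    · exact e2 (by linear_combination h' - h)
    · exact e1 (by linear_combination h' - h)
    · exact e3 (by linear_combination h' - h)
    · exact e2 (by linear_combination h' - h)
  · rw [hA.dotProduct_mulVec_add, hzero, hzero, hxy]
    ring

theorem statement1 (n : ℕ) [NeZero n] (hn : 5 ≤ n) (A : Matrix (Fin n) (Fin n) ℝ)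
    (hA : A.IsSymm) (hcop : Copositive A)
    (u : Fin n → Fin n → ℝ)
    (hnn : ∀ j i, 0 ≤ u j i)
    (hsupp : ∀ j, supp (u j) = circIdx n j)
    (hzero : ∀ j, u j ⬝ᵥ A.mulVec (u j) = 0) :
    List.TFAE [
      A.PosSemidef,
      ∃ j : Fin n, u j ⬝ᵥ A.mulVec (u (j + 1)) = 0,
      ∀ j : Fin n, u j ⬝ᵥ A.mulVec (u (j + 1)) = 0,
      ∃ P N : Matrix (Fin n) (Fin n) ℝ,
        P.PosSemidef ∧ N.IsSymm ∧ (∀ i k, 0 ≤ N i k) ∧ A = P + N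
    ] := by
  have hmem : ∀ i j, i ∈ circIdx n j → 0 < u j i := by
    intro i j h
    rwa [← hsupp j] at h
  tfae_have 1 → 3 := by
    intro h j
    have hAu : A *ᵥ u (j + 1) = 0 := by
      rw [← h.dotProduct_mulVec_zero_iff]
      simpa using hzero (j + 1)
    rw [hAu, dotProduct_zero]
  tfae_have 3 → 2 := fun h => ⟨0, h 0⟩
  tfae_have 2 → 1 := by
    rintro ⟨j, hj⟩
    exact posSemidef_of_exists_dotProduct_mulVec_eq_zero hn hA hcop hnn
      (fun i j h1 h2 => hmem i j (mem_circIdx_of_ne (by omega) h1 h2)) hzero hj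
  tfae_have 1 → 4 := fun h => ⟨A, 0, h, isSymm_zero, fun _ _ => le_rfl, (add_zero A).symm⟩
  tfae_have 4 → 1 := by
    rintro ⟨P, N, hP, -, hN, rfl⟩
    have hN0 : N = 0 := by
      ext i k
      obtain ⟨j, hi, hk⟩ := exists_mem_circIdx hn i k
      refine apply_eq_zero_of_dotProduct_mulVec_nonpos hN (hnn j) ?_ (hmem i j hi) (hmem k j hk)
      have hPu : 0 ≤ u j ⬝ᵥ P *ᵥ u j := by simpa using hP.dotProduct_mulVec_nonneg (u j)
      have hsum := hzero j
      rw [add_mulVec, dotProduct_add] at hsum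
      linarith
    simpa [hN0] using hP
  tfae_finish
end

section
/- Let n ≥ 6 be even and let A be an exceptional copositive n×n matrix possessing zeros u^1,…,u^n with Supp u^j = I_j for all j = 1,…,n, such that every zero of A is proportional to one of u^1,…,u^n (i.e., A has minimal circulant zero support set). Then A is not extremal; more precisely, there exist an exceptional copositive matrix B possessing zeros with supports I_1,…,I_n and having a zero not proportional to any zero with support among I_1,…,I_n being minimal (i.e., B has non-minimal circulant zero support set), and a nonzero vector w ∈ ℝⁿ, such that A = B + wwᵀ. -/
open Matrix

/-- The companion matrix of the recurrence `∑ i ≤ m + 1, c i * h i = 0`, mapping a window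
`(h 0, …, h m)` to the shifted window `(h 1, …, h (m + 1))`. -/
noncomputable def windowShift (m : ℕ) (c : ℕ → ℝ) : Matrix (Fin (m + 1)) (Fin (m + 1)) ℝ :=
  Matrix.of fun i j => Fin.lastCases (motive := fun _ => ℝ) (-(c j / c (m + 1)))
    (fun i' : Fin m => if j = i'.succ then 1 else 0) i

lemma windowShift_mulVec_castSucc (m : ℕ) (c : ℕ → ℝ) (x : Fin (m + 1) → ℝ) (i : Fin m) :
    (windowShift m c *ᵥ x) i.castSucc = x i.succ := by
  simp [windowShift, mulVec, dotProduct]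

lemma windowShift_mulVec_last (m : ℕ) (c : ℕ → ℝ) (x : Fin (m + 1) → ℝ) :
    (windowShift m c *ᵥ x) (Fin.last m) = -(∑ j : Fin (m + 1), c j * x j) / c (m + 1) := by
  simp only [windowShift, mulVec, dotProduct, Matrix.of_apply, Fin.lastCases_last,
    neg_div, Finset.sum_div, ← Finset.sum_neg_distrib]
  exact Finset.sum_congr rfl fun j _ => by ring

lemma windowShift_mulVec (m : ℕ) (c : ℕ → ℝ) (hc : c (m + 1) ≠ 0) (h : ℕ → ℝ)
    (hh : ∑ i : Fin (m + 2), c i * h i = 0) :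
    (windowShift m c *ᵥ fun i => h i) = fun i : Fin (m + 1) => h (i + 1) := by
  rw [Fin.sum_univ_castSucc] at hh
  ext i
  induction i using Fin.lastCases with
  | last =>
    rw [windowShift_mulVec_last, div_eq_iff hc]
    simp only [Fin.val_castSucc, Fin.val_last] at hh ⊢
    linarith
  | cast i => rw [windowShift_mulVec_castSucc]; simp

lemma det_windowShift (m : ℕ) (hm : Even m) (c : ℕ → ℝ) :
    (windowShift m c).det = -(c 0 / c (m + 1)) := by
  rw [Matrix.det_succ_column_zero, Fin.sum_univ_castSucc, Finset.sum_eq_zero]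
  · have h1 : (windowShift m c).submatrix (Fin.last m).succAbove Fin.succ = 1 := by
      ext i j
      simp [windowShift, Matrix.one_apply, eq_comm]
    rw [h1]
    simp [windowShift, hm.neg_one_pow]
  · intro i _
    simp [windowShift, (Fin.succ_ne_zero i).symm]

/-- Products of consecutive window shifts. -/
noncomputable def monodromy (m : ℕ) (c : ℕ → ℕ → ℝ) : ℕ → Matrix (Fin (m + 1)) (Fin (m + 1)) ℝ
  | 0 => 1
  | t + 1 => windowShift m (c t) * monodromy m c t

lemma monodromy_det_sign (m : ℕ) (hm : Even m) (c : ℕ → ℕ → ℝ)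
    (hc : ∀ t, ∀ i ≤ m + 1, 0 < c t i) (t : ℕ) : 0 < (-1) ^ t * (monodromy m c t).det := by
  induction t with
  | zero => simp [monodromy]
  | succ t ih =>
    have := mul_pos (div_pos (hc t 0 (by omega)) (hc t (m + 1) le_rfl)) ih
    rw [monodromy, det_mul, det_windowShift m hm]
    rw [pow_succ]
    linarith

/-- The window of a doubly indexed sequence starting at `t`. -/
def window (m : ℕ) (a : ℕ → ℕ → ℝ) (t : ℕ) : Matrix (Fin (m + 1)) (Fin (m + 1)) ℝ :=
  Matrix.of fun i j => a (t + i) (t + j)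

lemma windowShift_window (m : ℕ) (a : ℕ → ℕ → ℝ) (c : ℕ → ℝ) (hc : c (m + 1) ≠ 0) (t : ℕ)
    (ha : ∀ s r, a s r = a r s)
    (h : ∀ k ≤ m + 1, ∑ i : Fin (m + 2), c i * a (t + i) (t + k) = 0) :
    windowShift m c * window m a t * (windowShift m c)ᵀ = window m a (t + 1) := by
  have h1 : ∀ i k : Fin (m + 1),
      (windowShift m c * window m a t) i k = a (t + (i + 1)) (t + k) := fun i k =>
    congrFun (windowShift_mulVec m c hc (fun i => a (t + i) (t + k)) (h k (by omega))) i
  ext i k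
  have h2 := congrFun (windowShift_mulVec m c hc (fun k => a (t + (i + 1)) (t + k))
    (by simpa only [ha (t + (i + 1))] using h (i + 1) (by omega))) k
  simp only [mulVec, dotProduct] at h2
  rw [Matrix.mul_apply]
  simp only [h1, Matrix.transpose_apply]
  rw [window, Matrix.of_apply, add_right_comm, add_right_comm t 1 k, add_assoc, add_assoc t k 1,
    ← h2]
  exact Finset.sum_congr rfl fun j _ => mul_comm _ _

lemma monodromy_window (m : ℕ) (a c : ℕ → ℕ → ℝ)
    (hc : ∀ t, c t (m + 1) ≠ 0) (ha : ∀ s r, a s r = a r s)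
    (h : ∀ t, ∀ k ≤ m + 1, ∑ i : Fin (m + 2), c t i * a (t + i) (t + k) = 0) (t : ℕ) :
    monodromy m c t * window m a 0 * (monodromy m c t)ᵀ = window m a t := by
  induction t with
  | zero => simp [monodromy]
  | succ t ih =>
    rw [← windowShift_window m a (c t) (hc t) t ha (h t), ← ih, monodromy, transpose_mul]
    simp only [Matrix.mul_assoc]

/-- An isometry of determinant one of a nondegenerate form in odd dimension has a fixed vector. -/
lemma exists_fixed_of_isometry {d : ℕ} (hd : Odd d) (M G : Matrix (Fin d) (Fin d) ℝ)
    (hG : G.det ≠ 0) (hM : 0 < M.det) (h : M * G * Mᵀ = G) : ∃ x ≠ 0, M *ᵥ x = x := by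
  have h1 : M.det = 1 := by
    have := congrArg Matrix.det h
    rw [det_mul, det_mul, det_transpose] at this
    have h2 : M.det * M.det = 1 := mul_right_cancel₀ hG (by linarith)
    nlinarith
  have h2 : (M - 1) * G * Mᵀ = -(G * (M - 1)ᵀ) := by
    simp only [sub_mul, transpose_sub, mul_sub, h, one_mul, transpose_one, mul_one, neg_sub]
  have h3 : (M - 1).det = 0 := by
    have := congrArg Matrix.det h2
    rw [det_mul, det_mul, det_neg, det_mul, det_transpose, det_transpose, h1, Fintype.card_fin,
      hd.neg_one_pow] at this
    have h4 : (M - 1).det * G.det = 0 := by linarith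
    exact (mul_eq_zero.mp h4).resolve_right hG
  obtain ⟨x, hx, hx'⟩ := Matrix.exists_mulVec_eq_zero_iff.mpr h3
  exact ⟨x, hx, by rwa [sub_mulVec, one_mulVec, sub_eq_zero] at hx'⟩

/-- A recurrence with positive periodic coefficients that preserves a nondegenerate form on
windows of odd length has a nonzero periodic solution when the period is even. -/
lemma exists_periodic_solution (n m : ℕ) (hn : Even n) (hm : Even m) (a c : ℕ → ℕ → ℝ)
    (hc : ∀ t, ∀ i ≤ m + 1, 0 < c t i) (ha : ∀ s r, a s r = a r s)
    (h : ∀ t, ∀ k ≤ m + 1, ∑ i : Fin (m + 2), c t i * a (t + i) (t + k) = 0)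
    (hap : ∀ s r, a (s + n) (r + n) = a s r) (hcp : ∀ t, c (t + n) = c t)
    (hdet : (window m a 0).det ≠ 0) :
    ∃ w : ℕ → ℝ, (∀ t, w (t + n) = w t) ∧ (∃ t ≤ m, w t ≠ 0) ∧
      ∀ t, ∑ i : Fin (m + 2), c t i * w (t + i) = 0 := by
  have hcl : ∀ t, c t (m + 1) ≠ 0 := fun t => (hc t _ le_rfl).ne'
  have hwin : window m a n = window m a 0 := by
    ext i j
    simpa [window, add_comm] using hap i j
  obtain ⟨x, hx0, hx⟩ := exists_fixed_of_isometry hm.add_one (monodromy m c n) (window m a 0) hdet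
    (by simpa [hn.neg_one_pow] using monodromy_det_sign m hm c hc n)
    ((monodromy_window m a c hcl ha h n).trans hwin)
  set X : ℕ → Fin (m + 1) → ℝ := fun t => monodromy m c t *ᵥ x with hX
  have hX0 : X 0 = x := by simp [hX, monodromy]
  have hXs : ∀ t, X (t + 1) = windowShift m (c t) *ᵥ X t := fun t => by
    simp [hX, monodromy, mulVec_mulVec]
  have hXn : ∀ t, X (t + n) = X t := fun t => by
    induction t with
    | zero => rw [zero_add, hX0]; exact hx
    | succ t ih => rw [add_right_comm, hXs, hXs, ih, hcp]
  have hXw : ∀ (i : Fin (m + 1)) (t : ℕ), X t i = X (t + i) 0 := fun i => by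
    induction i using Fin.induction with
    | zero => simp
    | succ i ih =>
      intro t
      rw [← windowShift_mulVec_castSucc m (c t) (X t), ← hXs, ih]
      rw [Fin.val_castSucc, Fin.val_succ, add_right_comm, add_assoc]
  refine ⟨fun t => X t 0, fun t => by simp only [hXn], ?_, fun t => ?_⟩
  · obtain ⟨i, hi⟩ := Function.ne_iff.mp hx0
    refine ⟨i, by omega, ?_⟩
    have := hXw i 0
    rw [zero_add, hX0] at this
    rwa [Pi.zero_apply, this] at hi
  · have h1 := hXw (Fin.last m) (t + 1)
    rw [hXs, windowShift_mulVec_last, div_eq_iff (hcl t)] at h1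
    rw [Fin.sum_univ_castSucc]
    simp only [Fin.val_castSucc, Fin.val_last, ← hXw] at h1 ⊢
    rw [show t + (m + 1) = t + 1 + m by ring]
    linarith

section CopositiveForms

variable {n : ℕ} {B : Matrix (Fin n) (Fin n) ℝ}

lemma dotProduct_mulVec_symm_s6 (hB : B.IsSymm) (x y : Fin n → ℝ) :
    x ⬝ᵥ B *ᵥ y = y ⬝ᵥ B *ᵥ x := by
  rw [dotProduct_mulVec, ← mulVec_transpose, hB.eq, dotProduct_comm]

lemma quadForm_add_smul_s6 (hB : B.IsSymm) (x y : Fin n → ℝ) (s : ℝ) :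
    (x + s • y) ⬝ᵥ B *ᵥ (x + s • y) =
      x ⬝ᵥ B *ᵥ x + 2 * s * (y ⬝ᵥ B *ᵥ x) + s ^ 2 * (y ⬝ᵥ B *ᵥ y) := by
  simp only [mulVec_add, mulVec_smul, add_dotProduct, dotProduct_add, smul_dotProduct,
    dotProduct_smul, smul_eq_mul, dotProduct_mulVec_symm_s6 hB x y]
  ring

lemma quadForm_smul (s : ℝ) (x : Fin n → ℝ) :
    (s • x) ⬝ᵥ B *ᵥ (s • x) = s ^ 2 * (x ⬝ᵥ B *ᵥ x) := by
  simp only [mulVec_smul, smul_dotProduct, dotProduct_smul, smul_eq_mul]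
  ring

lemma IsZeroOf.mulVec_nonneg (hB : B.IsSymm) (hcop : Copositive B) {u : Fin n → ℝ}
    (hu : IsZeroOf B u) (i : Fin n) : 0 ≤ (B *ᵥ u) i := by
  obtain ⟨-, h0, hq⟩ := hu
  by_contra! h
  set b := B i i with hb
  have key : ∀ s : ℝ, 0 ≤ s → 0 ≤ 2 * s * (B *ᵥ u) i + s ^ 2 * b := fun s hs => by
    have := hcop (u + s • Pi.single i 1) fun j => by
      have h1 : (0 : ℝ) ≤ Pi.single (M := fun _ => ℝ) i 1 j := by
        by_cases hj : j = i
        · subst hj; simp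
        · simp [hj]
      have := mul_nonneg hs h1
      simpa using add_nonneg (h0 j) this
    rw [quadForm_add_smul_s6 hB, hq] at this
    simpa [hb] using this
  have hpos : 0 < |b| + 1 := by positivity
  have := key (-(B *ᵥ u) i / (|b| + 1)) (by apply div_nonneg <;> linarith)
  set a := (B *ᵥ u) i
  have h2 : 2 * (-a / (|b| + 1)) * a + (-a / (|b| + 1)) ^ 2 * b
      = a ^ 2 * (b - 2 * (|b| + 1)) / (|b| + 1) ^ 2 := by
    field_simp
    ring
  rw [h2] at this
  have h3 : a ^ 2 * (b - 2 * (|b| + 1)) / (|b| + 1) ^ 2 < 0 := by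
    apply div_neg_of_neg_of_pos _ (by positivity)
    have : 0 < a ^ 2 := by have := h.ne; positivity
    nlinarith [le_abs_self b, abs_nonneg b]
  linarith

lemma IsZeroOf.mulVec_eq_zero (hB : B.IsSymm) (hcop : Copositive B) {u : Fin n → ℝ}
    (hu : IsZeroOf B u) {i : Fin n} (hi : i ∈ supp u) : (B *ᵥ u) i = 0 := by
  have h := (Finset.sum_eq_zero_iff_of_nonneg fun j _ =>
    mul_nonneg (hu.2.1 j) (hu.mulVec_nonneg hB hcop j)).mp hu.2.2 i (Finset.mem_univ i)
  exact (mul_eq_zero.mp h).resolve_left (ne_of_gt hi)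

lemma IsZeroOf.dotProduct_mulVec_eq_zero (hB : B.IsSymm) (hcop : Copositive B) {u : Fin n → ℝ}
    (hu : IsZeroOf B u) {y : Fin n → ℝ} (hy : ∀ i ∉ supp u, y i = 0) :
    y ⬝ᵥ B *ᵥ u = 0 := by
  refine Finset.sum_eq_zero fun i _ => ?_
  by_cases hi : i ∈ supp u
  · rw [hu.mulVec_eq_zero hB hcop hi, mul_zero]
  · rw [hy i hi, zero_mul]

/-- A small perturbation of a nonnegative vector within its support has the same support. -/
lemma exists_pos_perturbation {u : Fin n → ℝ} (h0 : ∀ i, 0 ≤ u i) {y : Fin n → ℝ}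
    (hy : ∀ i ∉ supp u, y i = 0) :
    ∃ s : ℝ, 0 < s ∧ (∀ i, 0 ≤ (u + s • y) i) ∧ supp (u + s • y) = supp u := by
  have hsum : 0 ≤ ∑ i, |y i| / u i := Finset.sum_nonneg fun i _ => div_nonneg (abs_nonneg _) (h0 i)
  set S := ∑ i, |y i| / u i with hS
  have hpos : ∀ i ∈ supp u, 0 < (u + (1 + S)⁻¹ • y) i := fun i hi => by
    have hi : 0 < u i := hi
    have h1 : |y i| / u i ≤ S := Finset.single_le_sum (f := fun i => |y i| / u i)
      (fun i _ => div_nonneg (abs_nonneg _) (h0 i)) (Finset.mem_univ i)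
    rw [div_le_iff₀ hi] at h1
    have h2 : 0 < (1 + S) * u i + y i := by nlinarith [neg_abs_le (y i)]
    have h3 : (u + (1 + S)⁻¹ • y) i = (1 + S)⁻¹ * ((1 + S) * u i + y i) := by
      simp only [Pi.add_apply, Pi.smul_apply, smul_eq_mul]
      field_simp
    rw [h3]
    positivity
  have hzero : ∀ i ∉ supp u, (u + (1 + S)⁻¹ • y) i = 0 := fun i hi => by
    have : u i = 0 := le_antisymm (not_lt.mp hi) (h0 i)
    simp [this, hy i hi]
  refine ⟨(1 + S)⁻¹, by positivity, fun i => ?_, ?_⟩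
  · by_cases hi : i ∈ supp u
    · exact (hpos i hi).le
    · exact (hzero i hi).ge
  · ext i
    refine ⟨fun hi => ?_, hpos i⟩
    by_contra h
    exact absurd (hzero i h) (ne_of_gt hi)

lemma IsZeroOf.quadForm_nonneg (hB : B.IsSymm) (hcop : Copositive B) {u : Fin n → ℝ}
    (hu : IsZeroOf B u) {y : Fin n → ℝ} (hy : ∀ i ∉ supp u, y i = 0) : 0 ≤ y ⬝ᵥ B *ᵥ y := by
  obtain ⟨s, hs, h0, -⟩ := exists_pos_perturbation hu.2.1 hy
  have := hcop _ h0
  rw [quadForm_add_smul_s6 hB, hu.2.2, hu.dotProduct_mulVec_eq_zero hB hcop hy] at this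
  have h2 : 0 < s ^ 2 := by positivity
  exact nonneg_of_mul_nonneg_right (by linarith : 0 ≤ s ^ 2 * (y ⬝ᵥ B *ᵥ y)) h2

lemma IsZeroOf.exists_add_smul (hB : B.IsSymm) (hcop : Copositive B) {u : Fin n → ℝ}
    (hu : IsZeroOf B u) {y : Fin n → ℝ} (hy : ∀ i ∉ supp u, y i = 0)
    (hq : y ⬝ᵥ B *ᵥ y = 0) :
    ∃ s : ℝ, 0 < s ∧ IsZeroOf B (u + s • y) ∧ supp (u + s • y) = supp u := by
  obtain ⟨s, hs, h0, hsupp⟩ := exists_pos_perturbation hu.2.1 hy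
  refine ⟨s, hs, ⟨fun h => ?_, h0, ?_⟩, hsupp⟩
  · rw [h] at hsupp
    obtain ⟨i, hi⟩ := Function.ne_iff.mp hu.1
    have : i ∈ supp u := lt_of_le_of_ne (hu.2.1 i) (Ne.symm hi)
    rw [← hsupp] at this
    simp [supp] at this
  · rw [quadForm_add_smul_s6 hB, hu.2.2, hu.dotProduct_mulVec_eq_zero hB hcop hy, hq]
    ring

/-- Cauchy-Schwarz for the form of a copositive matrix on the face spanned by a zero. -/
lemma IsZeroOf.sq_le_mul (hB : B.IsSymm) (hcop : Copositive B) {u : Fin n → ℝ}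
    (hu : IsZeroOf B u) {x y : Fin n → ℝ} (hx : ∀ i ∉ supp u, x i = 0)
    (hy : ∀ i ∉ supp u, y i = 0) :
    (y ⬝ᵥ B *ᵥ x) ^ 2 ≤ (x ⬝ᵥ B *ᵥ x) * (y ⬝ᵥ B *ᵥ y) := by
  have h : ∀ s : ℝ, 0 ≤ (y ⬝ᵥ B *ᵥ y) * (s * s) + 2 * (y ⬝ᵥ B *ᵥ x) * s + x ⬝ᵥ B *ᵥ x :=
    fun s => by
    have := hu.quadForm_nonneg hB hcop (y := x + s • y) fun i hi => by simp [hx i hi, hy i hi]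
    rw [quadForm_add_smul_s6 hB] at this
    linarith
  have := discrim_le_zero h
  rw [discrim] at this
  linarith

lemma isSymm_sub_smul_vecMulVec (hB : B.IsSymm) (w : Fin n → ℝ) (t : ℝ) :
    (B - t • vecMulVec w w).IsSymm := by
  rw [Matrix.IsSymm, transpose_sub, hB.eq, transpose_smul, transpose_vecMulVec]

lemma sub_smul_vecMulVec_mulVec (w x : Fin n → ℝ) (t : ℝ) :
    (B - t • vecMulVec w w) *ᵥ x = B *ᵥ x - (t * (w ⬝ᵥ x)) • w := by
  rw [sub_mulVec, smul_mulVec, vecMulVec_mulVec]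
  ext i
  simp
  ring

lemma quadForm_sub_smul_vecMulVec (w x : Fin n → ℝ) (t : ℝ) :
    x ⬝ᵥ (B - t • vecMulVec w w) *ᵥ x = x ⬝ᵥ B *ᵥ x - t * (w ⬝ᵥ x) ^ 2 := by
  rw [sub_smul_vecMulVec_mulVec, dotProduct_sub, dotProduct_smul, smul_eq_mul, dotProduct_comm x w]
  ring

lemma continuous_mulVec_apply (i : Fin n) : Continuous fun x : Fin n → ℝ => (B *ᵥ x) i := by
  simp only [mulVec, dotProduct]
  fun_prop

lemma continuous_quadForm : Continuous fun x : Fin n → ℝ => x ⬝ᵥ B *ᵥ x := by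
  simp only [mulVec, dotProduct]
  fun_prop

/-- A form that is nonnegative on a face, and whose gradient at a point of the face points inwards,
is nonnegative on the orthant near that point. -/
lemma eventually_quadForm_nonneg (hB : B.IsSymm) (I : Set (Fin n)) (z : Fin n → ℝ)
    (hz : ∀ i ∉ I, z i = 0) (hpsd : ∀ y : Fin n → ℝ, (∀ i ∉ I, y i = 0) → 0 ≤ y ⬝ᵥ B *ᵥ y)
    (hpos : ∀ i ∉ I, 0 < (B *ᵥ z) i) :
    ∀ᶠ x in nhds z, (∀ i, 0 ≤ x i) → 0 ≤ x ⬝ᵥ B *ᵥ x := by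
  classical
  set r : (Fin n → ℝ) → Fin n → ℝ := fun x i => if i ∈ I then x i else 0 with hr
  have hrc : Continuous r := by
    refine continuous_pi fun i => ?_
    by_cases hi : i ∈ I <;> simp only [hr, hi, if_true, if_false] <;> fun_prop
  have hrz : r z = z := by
    ext i
    by_cases hi : i ∈ I <;> simp [hr, hi, hz]
  have hev : ∀ᶠ x in nhds z, ∀ i ∉ I, 0 < (B *ᵥ r x) i + (B *ᵥ x) i := by
    rw [Filter.eventually_all]
    intro i
    by_cases hi : i ∈ I
    · simp [hi]
    · have hc : Continuous fun x => (B *ᵥ r x) i + (B *ᵥ x) i :=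
        ((continuous_mulVec_apply i).comp hrc).add (continuous_mulVec_apply i)
      have := hc.continuousAt.eventually (lt_mem_nhds (show 0 < (B *ᵥ r z) i + (B *ᵥ z) i by
        rw [hrz]; linarith [hpos i hi]))
      exact this.mono fun x hx _ => hx
  refine hev.mono fun x hx h0 => ?_
  have h1 : x ⬝ᵥ B *ᵥ x = r x ⬝ᵥ B *ᵥ r x + (x - r x) ⬝ᵥ (B *ᵥ r x + B *ᵥ x) := by
    rw [dotProduct_add, sub_dotProduct, sub_dotProduct, dotProduct_mulVec_symm_s6 hB x (r x)]
    ring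
  rw [h1]
  refine add_nonneg (hpsd _ fun i hi => by simp [hr, hi]) (Finset.sum_nonneg fun i _ => ?_)
  by_cases hi : i ∈ I
  · simp [hr, hi]
  · simpa [hr, hi] using mul_nonneg (h0 i) (hx i hi).le

lemma copositive_of_stdSimplex (h : ∀ x ∈ stdSimplex ℝ (Fin n), 0 ≤ x ⬝ᵥ B *ᵥ x) :
    Copositive B := by
  intro x hx
  rcases eq_or_ne (∑ i, x i) 0 with h0 | h0
  · have : x = 0 := funext fun i =>
      (Finset.sum_eq_zero_iff_of_nonneg fun i _ => hx i).mp h0 i (Finset.mem_univ i)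
    simp [this]
  · have hs : 0 ≤ (∑ i, x i)⁻¹ := inv_nonneg.mpr (Finset.sum_nonneg fun i _ => hx i)
    have := h ((∑ i, x i)⁻¹ • x)
      ⟨fun i => mul_nonneg hs (hx i), by
        simp only [Pi.smul_apply, smul_eq_mul, ← Finset.mul_sum, inv_mul_cancel₀ h0]⟩
    rw [quadForm_smul] at this
    exact nonneg_of_mul_nonneg_right this (by positivity)

/-- If near every zero a positive multiple of `w wᵀ` can be subtracted, this can be done globally. -/
lemma exists_copositive_sub (hcop : Copositive B) (w : Fin n → ℝ)
    (hloc : ∀ z, IsZeroOf B z → ∃ ε : ℝ, 0 < ε ∧ ∀ᶠ x in nhds z, (∀ i, 0 ≤ x i) →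
      0 ≤ x ⬝ᵥ (B - ε • vecMulVec w w) *ᵥ x) :
    ∃ ε : ℝ, 0 < ε ∧ Copositive (B - ε • vecMulVec w w) := by
  have hmono : ∀ {ε δ : ℝ} {x : Fin n → ℝ}, δ ≤ ε →
      0 ≤ x ⬝ᵥ (B - ε • vecMulVec w w) *ᵥ x → 0 ≤ x ⬝ᵥ (B - δ • vecMulVec w w) *ᵥ x := by
    intro ε δ x h h1
    rw [quadForm_sub_smul_vecMulVec] at h1 ⊢
    nlinarith [sq_nonneg (w ⬝ᵥ x)]
  have key := (isCompact_stdSimplex ℝ (Fin n)).induction_on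
    (p := fun S => ∃ ε : ℝ, 0 < ε ∧ ∀ x ∈ S, (∀ i, 0 ≤ x i) →
      0 ≤ x ⬝ᵥ (B - ε • vecMulVec w w) *ᵥ x)
    ⟨1, one_pos, by simp⟩
    (fun S T hST ⟨ε, hε, h⟩ => ⟨ε, hε, fun x hx => h x (hST hx)⟩)
    (fun S T ⟨ε, hε, h⟩ ⟨δ, hδ, h'⟩ => ⟨min ε δ, lt_min hε hδ, fun x hx h0 => hx.elim
      (fun hx => hmono (min_le_left _ _) (h x hx h0))
      (fun hx => hmono (min_le_right _ _) (h' x hx h0))⟩) ?_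
  · obtain ⟨ε, hε, h⟩ := key
    exact ⟨ε, hε, copositive_of_stdSimplex fun x hx => h x hx hx.1⟩
  · intro z hz
    suffices ∃ ε : ℝ, 0 < ε ∧ ∀ᶠ x in nhds z, (∀ i, 0 ≤ x i) →
        0 ≤ x ⬝ᵥ (B - ε • vecMulVec w w) *ᵥ x by
      obtain ⟨ε, hε, h⟩ := this
      exact ⟨_, mem_nhdsWithin_of_mem_nhds h, ε, hε, fun x hx => hx⟩
    rcases (hcop z hz.1).eq_or_lt with hq | hq
    · exact hloc z ⟨by rintro rfl; simpa using hz.2, hz.1, hq.symm⟩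
    · have hp : 0 < (w ⬝ᵥ z) ^ 2 + 1 := by positivity
      refine ⟨(z ⬝ᵥ B *ᵥ z) / ((w ⬝ᵥ z) ^ 2 + 1), by positivity, ?_⟩
      have := (continuous_quadForm (B := B - ((z ⬝ᵥ B *ᵥ z) / ((w ⬝ᵥ z) ^ 2 + 1)) •
        vecMulVec w w)).continuousAt.eventually (lt_mem_nhds (a := 0) (b := z ⬝ᵥ (B -
          ((z ⬝ᵥ B *ᵥ z) / ((w ⬝ᵥ z) ^ 2 + 1)) • vecMulVec w w) *ᵥ z) ?_)
      · exact this.mono fun x hx _ => hx.le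
      · rw [quadForm_sub_smul_vecMulVec, div_mul_eq_mul_div, sub_pos, div_lt_iff₀ hp]
        nlinarith

/-- For a copositive matrix and `w ≠ 0` there is a largest multiple of `w wᵀ` that can be
subtracted. -/
lemma exists_max_copositive_sub (hcop : Copositive B) (w : Fin n → ℝ) (hw : w ≠ 0) :
    ∃ t : ℝ, Copositive (B - t • vecMulVec w w) ∧
      ∀ s, Copositive (B - s • vecMulVec w w) → s ≤ t := by
  set T : Set ℝ := {t | Copositive (B - t • vecMulVec w w)} with hT
  have h0 : (0 : ℝ) ∈ T := by simpa [hT] using hcop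
  obtain ⟨i, hi⟩ := Function.ne_iff.mp hw
  have hi : 0 < w i ^ 2 := by have : w i ≠ 0 := hi; positivity
  have hbdd : BddAbove T := by
    refine ⟨B i i / w i ^ 2, fun t ht => ?_⟩
    have := ht (Pi.single i 1) fun j => by
      by_cases hj : j = i
      · subst hj; simp
      · simp [hj]
    rw [quadForm_sub_smul_vecMulVec] at this
    rw [le_div_iff₀ hi]
    simp at this
    linarith
  have hcl : IsClosed T := by
    simp only [hT, Copositive, quadForm_sub_smul_vecMulVec, Set.ofPred_forall]
    refine isClosed_iInter fun x => isClosed_iInter fun _ => isClosed_le (by fun_prop) (by fun_prop)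
  exact ⟨sSup T, hcl.csSup_mem ⟨0, h0⟩ hbdd, fun s hs => le_csSup hbdd hs⟩

end CopositiveForms

section Circulant

/-- The residue of `t` as a cyclic index. -/
def cyc (m t : ℕ) : Fin (m + 4) := ⟨t % (m + 4), Nat.mod_lt _ (by omega)⟩

variable {m : ℕ}

@[simp] lemma cyc_val (j : Fin (m + 4)) : cyc m j = j := Fin.ext (Nat.mod_eq_of_lt j.2)

lemma cyc_val_add (t s : ℕ) : cyc m ((cyc m t : ℕ) + s) = cyc m (t + s) :=
  Fin.ext (Nat.mod_add_mod _ _ _)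

lemma cyc_add_period (t : ℕ) : cyc m (t + (m + 4)) = cyc m t := Fin.ext (Nat.add_mod_right _ _)

lemma cyc_add_injective {k : ℕ} (hk : k ≤ m + 4) (t : ℕ) :
    Function.Injective fun s : Fin k => cyc m (t + s) := fun s s' h => by
  have h1 : t + s ≡ t + s' [MOD m + 4] := congrArg Fin.val h
  exact Fin.ext ((Nat.ModEq.add_left_cancel' t h1).eq_of_lt_of_lt (by omega) (by omega))

lemma mem_circIdx_iff_exists {i j : Fin (m + 4)} :
    i ∈ circIdx (m + 4) j ↔ ∃ s : Fin (m + 2), cyc m (j + s) = i := Iff.rfl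

lemma mem_circIdx_iff_s6 {i j : Fin (m + 4)} :
    i ∈ circIdx (m + 4) j ↔
      ((j : ℕ) ≤ i ∧ (i : ℕ) < j + (m + 2)) ∨ (i : ℕ) + 2 < j := by
  rw [mem_circIdx_iff_exists]
  constructor
  · rintro ⟨s, rfl⟩
    have hs := s.2
    have hj := j.2
    rcases lt_or_ge ((j : ℕ) + s) (m + 4) with h | h
    · have : (cyc m (j + s) : ℕ) = j + s := Nat.mod_eq_of_lt h
      omega
    · have : (cyc m (j + s) : ℕ) = j + s - (m + 4) :=
        (Nat.mod_eq_sub_mod h).trans (Nat.mod_eq_of_lt (by omega))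
      omega
  · rintro (h | h)
    · refine ⟨⟨i - j, by omega⟩, ?_⟩
      rw [show (j : ℕ) + (i - j) = i by omega, cyc_val]
    · refine ⟨⟨i + (m + 4) - j, by omega⟩, ?_⟩
      rw [show (j : ℕ) + (i + (m + 4) - j) = i + (m + 4) by omega, cyc_add_period, cyc_val]

lemma exists_cyclic_pred (j : Fin (m + 4)) :
    ∃ p : Fin (m + 4), (p : ℕ) + 1 = j ∨ (p : ℕ) + 1 = j + (m + 4) := by
  by_cases h : (j : ℕ) = 0
  · exact ⟨⟨m + 3, by omega⟩, by simp only; omega⟩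
  · exact ⟨⟨j - 1, by omega⟩, by simp only; omega⟩

lemma circIdx_injective : Function.Injective (circIdx (m + 4)) := fun j k h => by
  have h' := fun i => (mem_circIdx_iff_s6 (i := i)).symm.trans
    ((Set.ext_iff.mp h i).trans mem_circIdx_iff_s6)
  obtain ⟨p, hp⟩ := exists_cyclic_pred j
  have h1 := h' p
  have h2 := h' j
  ext
  omega

lemma not_circIdx_ssubset {j l i : Fin (m + 4)} (h : circIdx (m + 4) j ⊆ circIdx (m + 4) l)
    (hi : i ∉ circIdx (m + 4) j) : i ∉ circIdx (m + 4) l := by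
  obtain ⟨p, hp⟩ := exists_cyclic_pred l
  obtain ⟨q, hq⟩ := exists_cyclic_pred p
  have h1 := mt (@h p)
  have h2 := mt (@h q)
  simp only [mem_circIdx_iff_s6] at *
  omega

lemma exists_circIdx_subset_insert {i j : Fin (m + 4)} (hi : i ∉ circIdx (m + 4) j) :
    ∃ k, i ∈ circIdx (m + 4) k ∧ ∀ s ∈ circIdx (m + 4) k, s ≠ i → s ∈ circIdx (m + 4) j := by
  simp only [mem_circIdx_iff_s6, ne_eq, Fin.ext_iff] at *
  by_cases h : (i : ℕ) + 1 = j ∨ (i : ℕ) + 1 = j + (m + 4)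
  · exact ⟨i, by omega, fun s => by omega⟩
  · by_cases hj : (j : ℕ) + 1 = m + 4
    · exact ⟨⟨0, by omega⟩, by simp only; omega, fun s => by simp only; omega⟩
    · exact ⟨⟨j + 1, by omega⟩, by simp only; omega, fun s => by simp only; omega⟩

lemma self_mem_circIdx (j : Fin (m + 4)) : j ∈ circIdx (m + 4) j :=
  mem_circIdx_iff_s6.mpr (by omega)

lemma sum_eq_sum_cyc {k : ℕ} (hk : k ≤ m + 4) (t : ℕ) (f : Fin (m + 4) → ℝ)
    (hf : ∀ i, (∀ s : Fin k, cyc m (t + s) ≠ i) → f i = 0) :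
    ∑ i, f i = ∑ s : Fin k, f (cyc m (t + s)) :=
  (Fintype.sum_of_injective _ (cyc_add_injective hk t) _ _
    (fun i hi => hf i fun s hs => hi ⟨s, hs⟩) fun _ => rfl).symm

/-- `B` is copositive, `u j` is a zero with support `I_j`, and there are no other zeros up to
proportionality. -/
structure MinimalCirculantZeros (B : Matrix (Fin (m + 4)) (Fin (m + 4)) ℝ)
    (u : Fin (m + 4) → Fin (m + 4) → ℝ) : Prop where
  symm : B.IsSymm
  cop : Copositive B
  zero : ∀ j, IsZeroOf B (u j)
  supp_eq : ∀ j, supp (u j) = circIdx (m + 4) j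
  minimal : ∀ v, IsZeroOf B v → ∃ j, ∃ c : ℝ, v = c • u j

namespace MinimalCirculantZeros

variable {B : Matrix (Fin (m + 4)) (Fin (m + 4)) ℝ} {u : Fin (m + 4) → Fin (m + 4) → ℝ}

lemma pos (h : MinimalCirculantZeros B u) {i j : Fin (m + 4)} (hi : i ∈ circIdx (m + 4) j) :
    0 < u j i := by
  rw [← h.supp_eq] at hi
  exact hi

lemma eq_zero (h : MinimalCirculantZeros B u) {i j : Fin (m + 4)} (hi : i ∉ circIdx (m + 4) j) :
    u j i = 0 := by
  rw [← h.supp_eq] at hi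
  exact le_antisymm (not_lt.mp hi) ((h.zero j).2.1 i)

lemma exists_pos_smul (h : MinimalCirculantZeros B u) {z : Fin (m + 4) → ℝ} (hz : IsZeroOf B z) :
    ∃ j, ∃ c : ℝ, 0 < c ∧ z = c • u j := by
  obtain ⟨j, c, rfl⟩ := h.minimal z hz
  refine ⟨j, c, lt_of_le_of_ne ?_ ?_, rfl⟩
  · exact nonneg_of_mul_nonneg_left (hz.2.1 j) (h.pos (self_mem_circIdx j))
  · rintro rfl
    exact hz.1 (zero_smul _ _)

lemma mulVec_pos (h : MinimalCirculantZeros B u) {i j : Fin (m + 4)}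
    (hi : i ∉ circIdx (m + 4) j) : 0 < (B *ᵥ u j) i := by
  refine lt_of_le_of_ne ((h.zero j).mulVec_nonneg h.symm h.cop i) fun h0 => ?_
  obtain ⟨k, hik, hk⟩ := exists_circIdx_subset_insert hi
  have hzero : IsZeroOf B (u j + (1 : ℝ) • u k) := by
    refine ⟨fun he => ?_, fun s => ?_, ?_⟩
    · have h1 := congrFun he j
      have h2 := h.pos (self_mem_circIdx j)
      have h3 := (h.zero k).2.1 j
      simp at h1
      linarith
    · simpa using add_nonneg ((h.zero j).2.1 s) ((h.zero k).2.1 s)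
    · rw [quadForm_add_smul_s6 h.symm, (h.zero j).2.2, (h.zero k).2.2]
      have : u k ⬝ᵥ B *ᵥ u j = 0 := Finset.sum_eq_zero fun s _ => by
        by_cases hs : s ∈ circIdx (m + 4) k
        · by_cases hsi : s = i
          · rw [hsi, ← h0, mul_zero]
          · rw [(h.zero j).mulVec_eq_zero h.symm h.cop, mul_zero]
            rw [h.supp_eq]
            exact hk s hs hsi
        · rw [h.eq_zero hs, zero_mul]
      rw [this]
      ring
  obtain ⟨l, c, hc, hl⟩ := h.exists_pos_smul hzero
  have hmem : ∀ s, 0 < (u j + (1 : ℝ) • u k) s → s ∈ circIdx (m + 4) l := fun s hs => by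
    by_contra hsl
    rw [hl, Pi.smul_apply, h.eq_zero hsl] at hs
    simp at hs
  refine not_circIdx_ssubset (fun s hs => hmem s ?_) hi (hmem i ?_)
  · simpa using add_pos_of_pos_of_nonneg (h.pos hs) ((h.zero k).2.1 s)
  · simpa using add_pos_of_nonneg_of_pos ((h.zero j).2.1 i) (h.pos hik)

lemma eq_zero_of_quadForm (h : MinimalCirculantZeros B u) {j k : Fin (m + 4)}
    {y : Fin (m + 4) → ℝ} (hy : ∀ i ∉ circIdx (m + 4) j, y i = 0) (hk : k ∈ circIdx (m + 4) j)
    (hyk : y k = 0) (hq : y ⬝ᵥ B *ᵥ y = 0) : y = 0 := by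
  rw [← h.supp_eq] at hy
  obtain ⟨s, hs, hz, hsupp⟩ := (h.zero j).exists_add_smul h.symm h.cop hy hq
  obtain ⟨l, c, hc, hl⟩ := h.exists_pos_smul hz
  have hjl : l = j := circIdx_injective <| by
    rw [← h.supp_eq, ← h.supp_eq, ← hsupp, hl]
    ext i
    simp [supp, hc]
  subst hjl
  have h1 := congrFun hl k
  simp only [Pi.add_apply, Pi.smul_apply, hyk, smul_eq_mul, mul_zero, add_zero] at h1
  have hc1 : c = 1 := by
    have := h.pos hk
    exact mul_right_cancel₀ this.ne' (by linarith)
  rw [hc1, one_smul, add_eq_left] at hl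
  exact (smul_eq_zero.mp hl).resolve_left hs.ne'

/-- The principal submatrix on the first `n - 3` indices of `I_j` is nonsingular. -/
lemma det_ne_zero (h : MinimalCirculantZeros B u) (j : Fin (m + 4)) :
    (B.submatrix (fun s : Fin (m + 1) => cyc m (j + s)) (fun s : Fin (m + 1) => cyc m (j + s))).det ≠ 0 := by
  intro h0
  obtain ⟨y, hy0, hy⟩ := Matrix.exists_mulVec_eq_zero_iff.mpr h0
  have hinj := cyc_add_injective (m := m) (k := m + 1) (by omega) j
  set e : Fin (m + 1) → Fin (m + 4) := fun s => cyc m (j + s) with he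
  set y' := Function.extend e y 0 with hy'
  have hext : ∀ i, (∀ s, e s ≠ i) → y' i = 0 := fun i hi => by
    rw [hy', Function.extend_apply' _ _ _ fun ⟨s, hs⟩ => hi s hs, Pi.zero_apply]
  have hey : ∀ s, y' (e s) = y s := fun s => hinj.extend_apply y 0 s
  have hBy : ∀ s, (B *ᵥ y') (e s) = 0 := fun s => by
    rw [mulVec, dotProduct, sum_eq_sum_cyc (k := m + 1) (by omega) j _
      fun i hi => by rw [hext i hi, mul_zero]]
    exact (Finset.sum_congr rfl fun t _ => congrArg _ (hey t)).trans (congrFun hy s)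
  have hq : y' ⬝ᵥ B *ᵥ y' = 0 := by
    rw [dotProduct, sum_eq_sum_cyc (k := m + 1) (by omega) j _
      fun i hi => by rw [hext i hi, zero_mul]]
    exact Finset.sum_eq_zero fun s _ => by rw [hBy, mul_zero]
  have hzero : y' = 0 := by
    refine h.eq_zero_of_quadForm (j := j) (k := cyc m (j + (m + 1))) (fun i hi => ?_)
      (mem_circIdx_iff_exists.mpr ⟨Fin.last _, rfl⟩) (hext _ fun s hs => ?_) hq
    · exact hext i fun s hs => hi (mem_circIdx_iff_exists.mpr ⟨s.castSucc, hs⟩)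
    · have := cyc_add_injective (m := m) (k := m + 2) (by omega) j
        (a₁ := s.castSucc) (a₂ := Fin.last _) hs
      exact s.castSucc_lt_last.ne this
  exact hy0 (funext fun s => by rw [← hey, hzero, Pi.zero_apply, Pi.zero_apply])

/-- A vector orthogonal to `u j` is in the range of `B` on the face `I_j`. -/
lemma exists_mulVec_eq (h : MinimalCirculantZeros B u) (j : Fin (m + 4)) {w : Fin (m + 4) → ℝ}
    (hw : u j ⬝ᵥ w = 0) :
    ∃ v : Fin (m + 4) → ℝ, (∀ i ∉ circIdx (m + 4) j, v i = 0) ∧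
      ∀ i ∈ circIdx (m + 4) j, (B *ᵥ v) i = w i := by
  have hdet := h.det_ne_zero j
  have hinj := cyc_add_injective (m := m) (k := m + 1) (by omega) j
  set e : Fin (m + 1) → Fin (m + 4) := fun s => cyc m (j + s) with he
  set W := B.submatrix e e with hW
  set v := Function.extend e (W⁻¹ *ᵥ (w ∘ e)) 0 with hv
  have hext : ∀ i, (∀ s, e s ≠ i) → v i = 0 := fun i hi => by
    rw [hv, Function.extend_apply' _ _ _ fun ⟨s, hs⟩ => hi s hs, Pi.zero_apply]
  have hev : ∀ s, v (e s) = (W⁻¹ *ᵥ (w ∘ e)) s := fun s => hinj.extend_apply _ 0 s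
  have hsupp : ∀ i ∉ circIdx (m + 4) j, v i = 0 := fun i hi =>
    hext i fun s hs => hi (mem_circIdx_iff_exists.mpr ⟨s.castSucc, hs⟩)
  have hBv : ∀ s, (B *ᵥ v) (e s) = w (e s) := fun s => by
    rw [mulVec, dotProduct, sum_eq_sum_cyc (k := m + 1) (by omega) j _
      fun i hi => by rw [hext i hi, mul_zero]]
    have : W *ᵥ (W⁻¹ *ᵥ (w ∘ e)) = w ∘ e := by
      rw [mulVec_mulVec, Matrix.mul_nonsing_inv _ (isUnit_iff_ne_zero.mpr hdet), one_mulVec]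
    rw [← Function.comp_apply (f := w), ← this]
    exact Finset.sum_congr rfl fun t _ => by rw [← hev]; rfl
  refine ⟨v, hsupp, fun i hi => ?_⟩
  obtain ⟨s, rfl⟩ := mem_circIdx_iff_exists.mp hi
  induction s using Fin.lastCases with
  | cast s => exact hBv s
  | last =>
    have h1 : u j ⬝ᵥ (B *ᵥ v - w) = 0 := by
      rw [dotProduct_sub, hw, dotProduct_mulVec_symm_s6 h.symm, sub_zero]
      exact (h.zero j).dotProduct_mulVec_eq_zero h.symm h.cop (by rwa [h.supp_eq])
    rw [dotProduct, sum_eq_sum_cyc (k := m + 2) (by omega) j _ fun i hi => by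
      rw [h.eq_zero fun hm => (mem_circIdx_iff_exists.mp hm).elim hi, zero_mul],
      Fin.sum_univ_castSucc, Finset.sum_eq_zero, zero_add] at h1
    · exact sub_eq_zero.mp ((mul_eq_zero.mp h1).resolve_left (h.pos hi).ne')
    · intro s _
      rw [Pi.sub_apply]
      exact mul_eq_zero_of_right _ (sub_eq_zero.mpr (hBv s))

lemma exists_copositive_sub (h : MinimalCirculantZeros B u) {w : Fin (m + 4) → ℝ}
    (hw : ∀ j, u j ⬝ᵥ w = 0) : ∃ ε : ℝ, 0 < ε ∧ Copositive (B - ε • vecMulVec w w) := by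
  refine _root_.exists_copositive_sub h.cop w fun z hz => ?_
  obtain ⟨j, c, hc, rfl⟩ := h.exists_pos_smul hz
  obtain ⟨v, hv, hBv⟩ := h.exists_mulVec_eq j (hw j)
  have hvv : 0 ≤ v ⬝ᵥ B *ᵥ v :=
    (h.zero j).quadForm_nonneg h.symm h.cop (by rwa [h.supp_eq])
  have hK : 0 < v ⬝ᵥ B *ᵥ v + 1 := by linarith
  refine ⟨(v ⬝ᵥ B *ᵥ v + 1)⁻¹, by positivity, eventually_quadForm_nonneg
    (isSymm_sub_smul_vecMulVec h.symm w _) (circIdx (m + 4) j) _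
    (fun i hi => by simp [h.eq_zero hi]) (fun y hy => ?_) fun i hi => ?_⟩
  · have h1 : w ⬝ᵥ y = y ⬝ᵥ B *ᵥ v := by
      rw [dotProduct_comm]
      refine Finset.sum_congr rfl fun i _ => ?_
      by_cases hi : i ∈ circIdx (m + 4) j
      · rw [hBv i hi]
      · rw [hy i hi, zero_mul, zero_mul]
    rw [← h.supp_eq] at hv hy
    have h2 := (h.zero j).sq_le_mul h.symm h.cop hv hy
    have h3 := (h.zero j).quadForm_nonneg h.symm h.cop hy
    rw [quadForm_sub_smul_vecMulVec, h1, sub_nonneg, inv_mul_le_iff₀ hK]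
    linarith
  · rw [sub_smul_vecMulVec_mulVec, dotProduct_smul, dotProduct_comm w, hw]
    simpa [mulVec_smul] using mul_pos hc (h.mulVec_pos hi)

/-- In even dimension the zeros are linearly dependent. -/
lemma exists_orthogonal (h : MinimalCirculantZeros B u) (hm : Even m) :
    ∃ w : Fin (m + 4) → ℝ, w ≠ 0 ∧ ∀ j, u j ⬝ᵥ w = 0 := by
  have hsum : ∀ (t : ℕ) (f : Fin (m + 4) → ℝ), u (cyc m t) ⬝ᵥ f =
      ∑ s : Fin (m + 2), u (cyc m t) (cyc m (t + s)) * f (cyc m (t + s)) := fun t f =>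
    sum_eq_sum_cyc (by omega) t _ fun i hi => by
      rw [h.eq_zero fun hmem => ?_, zero_mul]
      obtain ⟨s, hs⟩ := mem_circIdx_iff_exists.mp hmem
      exact hi s (by rwa [cyc_val_add] at hs)
  have hmem : ∀ t, ∀ i ≤ m + 1, cyc m (t + i) ∈ circIdx (m + 4) (cyc m t) := fun t i hi =>
    mem_circIdx_iff_exists.mpr ⟨⟨i, by omega⟩, cyc_val_add t i⟩
  have hrec : ∀ t, ∀ k ≤ m + 1, ∑ i : Fin (m + 2),
      u (cyc m t) (cyc m (t + i)) * B (cyc m (t + i)) (cyc m (t + k)) = 0 := fun t k hk => by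
    have h1 := (h.zero (cyc m t)).mulVec_eq_zero h.symm h.cop (i := cyc m (t + k))
      (by rw [h.supp_eq]; exact hmem t k hk)
    rw [mulVec, dotProduct_comm, hsum] at h1
    simpa only [h.symm.apply] using h1
  obtain ⟨w, hwp, ⟨t, ht, hwt⟩, hwu⟩ := exists_periodic_solution (m + 4) m
    (hm.add (by decide)) hm (fun s r => B (cyc m s) (cyc m r))
    (fun t i => u (cyc m t) (cyc m (t + i)))
    (fun t i hi => h.pos (hmem t i hi)) (fun s r => (h.symm.apply _ _).symm) hrec
    (fun s r => by simp only [cyc_add_period])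
    (fun t => by simp only [cyc_add_period, add_right_comm t (m + 4)])
    (h.det_ne_zero ⟨0, by omega⟩)
  have hper : ∀ t, w (cyc m t) = w t := Function.Periodic.map_mod_nat hwp
  refine ⟨fun i => w i, fun h0 => hwt ?_, fun j => ?_⟩
  · rw [← hper]
    exact congrFun h0 (cyc m t)
  · have := hsum j fun i => w i
    simp only [hper] at this
    rw [cyc_val] at this
    rw [this]
    simpa only [cyc_val] using hwu j

end MinimalCirculantZeros

end Circulant

theorem statement6 (n : ℕ) (hn : 6 ≤ n) (heven : Even n) (A : Matrix (Fin n) (Fin n) ℝ)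
    (hA : A.IsSymm) (hcop : Copositive A) (hexc : Exceptional A)
    (u : Fin n → Fin n → ℝ)
    (hu : ∀ j, IsZeroOf A (u j) ∧ supp (u j) = circIdx n j)
    (hmin : ∀ v, IsZeroOf A v → ∃ j : Fin n, ∃ c : ℝ, v = c • u j) :
    ¬ ExtremalCopositive A ∧
    ∃ B : Matrix (Fin n) (Fin n) ℝ, ∃ v : Fin n → Fin n → ℝ, ∃ w : Fin n → ℝ,
      B.IsSymm ∧ Copositive B ∧ Exceptional B ∧
      (∀ j, IsZeroOf B (v j) ∧ supp (v j) = circIdx n j) ∧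
      (∃ z, IsZeroOf B z ∧ ∀ (j : Fin n) (c : ℝ), z ≠ c • v j) ∧
      w ≠ 0 ∧ A = B + Matrix.vecMulVec w w := by
  have hAexc : ∀ (B : Matrix (Fin n) (Fin n) ℝ) (w : Fin n → ℝ), A = B + vecMulVec w w →
      Exceptional B := by
    rintro B w rfl ⟨P, N, hP, hN, hN0, rfl⟩
    refine hexc ⟨P + vecMulVec w w, N, hP.add ?_, hN, hN0, add_right_comm _ _ _⟩
    simpa using posSemidef_vecMulVec_self_star w
  suffices hmain : ∃ B : Matrix (Fin n) (Fin n) ℝ, ∃ v : Fin n → Fin n → ℝ, ∃ w : Fin n → ℝ,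
      B.IsSymm ∧ Copositive B ∧ Exceptional B ∧
      (∀ j, IsZeroOf B (v j) ∧ supp (v j) = circIdx n j) ∧
      (∃ z, IsZeroOf B z ∧ ∀ (j : Fin n) (c : ℝ), z ≠ c • v j) ∧
      w ≠ 0 ∧ A = B + Matrix.vecMulVec w w by
    refine ⟨fun hext => ?_, hmain⟩
    obtain ⟨B, v, w, -, hB, -, -, -, hw, hABw⟩ := hmain
    have hpsd : (vecMulVec w w).PosSemidef := by simpa using posSemidef_vecMulVec_self_star w
    have hww : Copositive (vecMulVec w w) := fun x _ => by simpa using hpsd.dotProduct_mulVec_nonneg x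
    obtain ⟨-, c, -, hc, -, hcw⟩ := hext.2 _ _ hB hww hABw
    rcases hc.eq_or_lt with rfl | hc
    · rw [zero_smul] at hcw
      refine hw (funext fun i => ?_)
      simpa [vecMulVec_apply] using congrFun (congrFun hcw i) i
    · refine hexc ⟨c⁻¹ • vecMulVec w w, 0, hpsd.smul (by positivity), Matrix.isSymm_zero,
        fun _ _ => le_rfl, ?_⟩
      rw [hcw, smul_smul, inv_mul_cancel₀ hc.ne', one_smul, add_zero]
  obtain ⟨m, rfl⟩ := Nat.exists_eq_add_of_le' (show 4 ≤ n by omega)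
  have hm : Even m := by
    rcases heven with ⟨k, hk⟩
    exact ⟨k - 2, by omega⟩
  have hmcz : MinimalCirculantZeros A u :=
    ⟨hA, hcop, fun j => (hu j).1, fun j => (hu j).2, hmin⟩
  obtain ⟨w, hw, hwu⟩ := hmcz.exists_orthogonal hm
  obtain ⟨ε, hε, hεcop⟩ := hmcz.exists_copositive_sub hwu
  obtain ⟨t, htcop, htmax⟩ := exists_max_copositive_sub hcop w hw
  have ht : 0 < t := hε.trans_le (htmax ε hεcop)
  have hAB : A = (A - t • vecMulVec w w) + vecMulVec (√t • w) (√t • w) := by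
    rw [smul_vecMulVec, vecMulVec_smul, smul_smul, Real.mul_self_sqrt ht.le, sub_add_cancel]
  have hzero : ∀ j, IsZeroOf (A - t • vecMulVec w w) (u j) := fun j =>
    ⟨(hu j).1.1, (hu j).1.2.1, by
      rw [quadForm_sub_smul_vecMulVec, (hu j).1.2.2, dotProduct_comm, hwu]
      ring⟩
  refine ⟨A - t • vecMulVec w w, u, √t • w, isSymm_sub_smul_vecMulVec hA w t, htcop,
    hAexc _ _ hAB, fun j => ⟨hzero j, (hu j).2⟩, ?_,
    smul_ne_zero (Real.sqrt_pos.mpr ht).ne' hw, hAB⟩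
  by_contra! hcon
  have hB : MinimalCirculantZeros (A - t • vecMulVec w w) u :=
    ⟨isSymm_sub_smul_vecMulVec hA w t, htcop, hzero, fun j => (hu j).2, hcon⟩
  obtain ⟨δ, hδ, hδcop⟩ := hB.exists_copositive_sub hwu
  have := htmax (t + δ) (by rwa [add_smul, ← sub_sub])
  linarith
end
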